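/- Let the coefficients satisfy Hypotheses (H), let G(t,s) be the associated evolution operator, and let {μ_t : t ≥ 0} be a tight evolution system of measures for G(t,s) such that each μ_t has a continuous density ρ(t,·) with respect to the Lebesgue measure. Then for each k ∈ ℕ there exists δ_k > 0 such that ρ(τ,x) ≥ δ_k for all τ ≥ 0 and all x with |x| ≤ k. -/

import Mathlib

open MeasureTheory Filter Topology Metric Set
open scoped RealInnerProductSpace

noncomputable section

abbrev Ed (d : ℕ) := EuclideanSpace ℝ (Fin d)

/-- `f` belongs to `C_b(ℝ^d)`: it is bounded and continuous. -/
def IsCb {d : ℕ} (f : Ed d → ℝ) : Prop :=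
  Continuous f ∧ ∃ M, ∀ x, |f x| ≤ M

/-- The action of the operator `A(t)φ = Tr(Q(t,·)D²φ) + ⟨b(t,·),∇φ⟩`. -/
def applyA {d : ℕ} (q : ℝ → Ed d → Matrix (Fin d) (Fin d) ℝ) (b : ℝ → Ed d → Ed d)
    (t : ℝ) (u : Ed d → ℝ) (x : Ed d) : ℝ :=
  (∑ i, ∑ j, q t x i j *
      iteratedFDeriv ℝ 2 u x ![EuclideanSpace.single i 1, EuclideanSpace.single j 1]) +
    ⟪b t x, gradient u x⟫

/-- `u` is a bounded classical solution (in `C_b([s,∞)×ℝ^d) ∩ C^{1,2}((s,∞)×ℝ^d)`)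
of `D_t u = A(t)u` on `(s,∞)×ℝ^d` with `u(s,·) = f`. -/
structure IsBoundedClassicalSolution {d : ℕ} (q : ℝ → Ed d → Matrix (Fin d) (Fin d) ℝ)
    (b : ℝ → Ed d → Ed d) (s : ℝ) (f : Ed d → ℝ) (u : ℝ → Ed d → ℝ) : Prop where
  cont : ContinuousOn (fun z : ℝ × Ed d => u z.1 z.2) (Ici s ×ˢ (univ : Set (Ed d)))
  bdd : ∃ M, ∀ t ∈ Ici s, ∀ x, |u t x| ≤ M
  smooth_space : ∀ t ∈ Ioi s, ContDiff ℝ 2 (u t)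
  pde : ∀ t ∈ Ioi s, ∀ x, HasDerivAt (fun τ => u τ x) (applyA q b t (u t) x) t
  init : ∀ x, u s x = f x

/-- Hypotheses (H), together with the associated evolution operator `G(t,s)`. -/
structure Hypotheses (d : ℕ) where
  /-- the Hölder exponent -/
  α : ℝ
  hα : α ∈ Ioo (0:ℝ) 1
  /-- the diffusion coefficients -/
  q : ℝ → Ed d → Matrix (Fin d) (Fin d) ℝ
  /-- the drift coefficients -/
  b : ℝ → Ed d → Ed d
  /-- the ellipticity function -/
  η : ℝ → Ed d → ℝ
  η₀ : ℝ
  -- (i): local regularity `C^{α/2,1+α}_loc`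
  q_diff : ∀ t ∈ Ici (0:ℝ), ∀ i j, Differentiable ℝ fun x => q t x i j
  b_diff : ∀ t ∈ Ici (0:ℝ), Differentiable ℝ (b t)
  q_locHolder : ∀ i j, ∀ T > (0:ℝ), ∀ R > (0:ℝ), ∃ L : ℝ,
    ∀ t ∈ Icc (0:ℝ) T, ∀ s ∈ Icc (0:ℝ) T,
      ∀ x ∈ closedBall (0 : Ed d) R, ∀ y ∈ closedBall (0 : Ed d) R,
        |q t x i j - q s y i j| ≤ L * (|t - s| ^ (α/2) + ‖x - y‖ ^ α) ∧
        ‖gradient (fun z => q t z i j) x - gradient (fun z => q s z i j) y‖ ≤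
          L * (|t - s| ^ (α/2) + ‖x - y‖ ^ α)
  b_locHolder : ∀ i, ∀ T > (0:ℝ), ∀ R > (0:ℝ), ∃ L : ℝ,
    ∀ t ∈ Icc (0:ℝ) T, ∀ s ∈ Icc (0:ℝ) T,
      ∀ x ∈ closedBall (0 : Ed d) R, ∀ y ∈ closedBall (0 : Ed d) R,
        |b t x i - b s y i| ≤ L * (|t - s| ^ (α/2) + ‖x - y‖ ^ α) ∧
        ‖gradient (fun z => b t z i) x - gradient (fun z => b s z i) y‖ ≤
          L * (|t - s| ^ (α/2) + ‖x - y‖ ^ α)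
  -- (i): boundedness on `[0,∞) × B_R` and uniform-in-time `L^p(B_R)` bounds
  q_bdd : ∀ R > (0:ℝ), ∃ M : ℝ, ∀ t ∈ Ici (0:ℝ), ∀ x ∈ ball (0 : Ed d) R, ∀ i j,
    |q t x i j| ≤ M
  q_cont : ∀ R > (0:ℝ), ∀ i j, ContinuousOn (fun z : ℝ × Ed d => q z.1 z.2 i j)
    (Ici (0:ℝ) ×ˢ ball (0 : Ed d) R)
  int_bdd : ∃ p : ℝ, (d : ℝ) + 2 < p ∧ ∀ R > (0:ℝ), ∃ M : ℝ, ∀ t ∈ Ici (0:ℝ), ∀ i j : Fin d,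
    (∫ x in ball (0 : Ed d) R, ‖gradient (fun z => q t z i j) x‖ ^ p) ≤ M ∧
    (∫ x in ball (0 : Ed d) R, |b t x j| ^ p) ≤ M
  -- (ii): symmetry and ellipticity
  q_symm : ∀ t ∈ Ici (0:ℝ), ∀ x, (q t x).IsSymm
  hη₀ : 0 < η₀
  η_lb : ∀ t ∈ Ici (0:ℝ), ∀ x, η₀ ≤ η t x
  ellipticity : ∀ t ∈ Ici (0:ℝ), ∀ x, ∀ ξ : Ed d,
    η t x * ‖ξ‖ ^ 2 ≤ ∑ i, ∑ j, q t x i j * ξ i * ξ j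
  -- (iii): Lyapunov function
  V : Ed d → ℝ
  V_pos : ∀ x, 0 < V x
  V_C2 : ContDiff ℝ 2 V
  V_tendsto : Tendsto V (comap (fun x : Ed d => ‖x‖) atTop) atTop
  a : ℝ
  κ : ℝ
  ha : 0 ≤ a
  hκ : 0 < κ
  lyapunov : ∀ t ∈ Ici (0:ℝ), ∀ x, applyA q b t V x ≤ a - κ * V x
  -- (iv): bounds on the space derivatives of the coefficients
  c₀ : ℝ
  r₀ : ℝ
  hc₀ : 0 ≤ c₀
  gradQ_bdd : ∀ t ∈ Ici (0:ℝ), ∀ x,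
    Real.sqrt (∑ i, ∑ j, ‖gradient (fun z => q t z i j) x‖ ^ 2) ≤ c₀ * η t x
  b_dissip : ∀ t ∈ Ici (0:ℝ), ∀ x, ∀ ξ : Ed d, ⟪fderiv ℝ (b t) x ξ, ξ⟫ ≤ r₀ * ‖ξ‖ ^ 2
  -- (v): growth conditions
  growth : ∃ c > (0:ℝ),
    (∀ t ∈ Ici (0:ℝ), ∀ x,
        Real.sqrt (∑ i, ∑ j, (q t x i j) ^ 2) ≤ c * (1 + ‖x‖) * V x ∧
        ⟪b t x, x⟫ ≤ c * (1 + ‖x‖ ^ 2) * V x) ∨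
    (∀ t ∈ Ici (0:ℝ), ∀ x, Real.sqrt (∑ i, ∑ j, (q t x i j) ^ 2) ≤ c)
  /-- the evolution operator -/
  G : ℝ → ℝ → (Ed d → ℝ) → Ed d → ℝ
  G_sol : ∀ s ∈ Ici (0:ℝ), ∀ f, IsCb f →
    IsBoundedClassicalSolution q b s f fun t => G t s f
  G_unique : ∀ s ∈ Ici (0:ℝ), ∀ f, IsCb f → ∀ u,
    IsBoundedClassicalSolution q b s f u → ∀ t ∈ Ici s, ∀ x, u t x = G t s f x

/-- `{μ_t : t ≥ 0}` is an evolution system of measures for `G(t,s)`. -/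
def IsEvolutionSystem {d : ℕ} (H : Hypotheses d) (μ : ℝ → Measure (Ed d)) : Prop :=
  (∀ t ∈ Ici (0:ℝ), IsProbabilityMeasure (μ t)) ∧
    ∀ f, IsCb f → ∀ s ∈ Ici (0:ℝ), ∀ t ∈ Ici s,
      ∫ x, H.G t s f x ∂μ t = ∫ x, f x ∂μ s

/-- The system `{μ_t : t ≥ 0}` is tight. -/
def IsTightSystem {d : ℕ} (μ : ℝ → Measure (Ed d)) : Prop :=
  ∀ ε > (0:ℝ), ∃ R > (0:ℝ), ∀ t ∈ Ici (0:ℝ),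
    ENNReal.ofReal (1 - ε) ≤ μ t (ball (0 : Ed d) R)

lemma applyA_eq {d : ℕ} (q : ℝ → Ed d → Matrix (Fin d) (Fin d) ℝ) (b : ℝ → Ed d → Ed d)
    (t : ℝ) (u : Ed d → ℝ) (x : Ed d) :
    applyA q b t u x = (∑ i, ∑ j, q t x i j *
      fderiv ℝ (fderiv ℝ u) x (EuclideanSpace.single i 1) (EuclideanSpace.single j 1)) +
      fderiv ℝ u x (b t x) := by
  unfold applyA
  simp only [iteratedFDeriv_two_apply, inner_gradient_right]
  simp

lemma fderiv_fderiv_sub {d : ℕ} {u w : Ed d → ℝ} {x : Ed d} (hu : ContDiffAt ℝ 2 u x)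
    (hw : ContDiffAt ℝ 2 w x) :
    fderiv ℝ (fderiv ℝ (fun y => u y - w y)) x
      = fderiv ℝ (fderiv ℝ u) x - fderiv ℝ (fderiv ℝ w) x := by
  have h1 : fderiv ℝ (fun y => u y - w y) =ᶠ[𝓝 x] fun y => fderiv ℝ u y - fderiv ℝ w y := by
    filter_upwards [hu.eventually (by simp), hw.eventually (by simp)] with y h1 h2
    exact fderiv_fun_sub (h1.differentiableAt (by simp)) (h2.differentiableAt (by simp))
  rw [h1.fderiv_eq]
  exact fderiv_fun_sub ((hu.fderiv_right (m := 1) (by norm_num)).differentiableAt (by simp))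
    ((hw.fderiv_right (m := 1) (by norm_num)).differentiableAt (by simp))

lemma applyA_sub {d : ℕ} (q : ℝ → Ed d → Matrix (Fin d) (Fin d) ℝ) (b : ℝ → Ed d → Ed d)
    (t : ℝ) {u w : Ed d → ℝ} {x : Ed d} (hu : ContDiffAt ℝ 2 u x) (hw : ContDiffAt ℝ 2 w x) :
    applyA q b t (fun y => u y - w y) x = applyA q b t u x - applyA q b t w x := by
  simp only [applyA_eq, fderiv_fderiv_sub hu hw]
  rw [fderiv_fun_sub (hu.differentiableAt (by simp)) (hw.differentiableAt (by simp))]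
  simp only [_root_.sub_apply, mul_sub, Finset.sum_sub_distrib]
  ring

lemma hess_nonneg {d : ℕ} {v : Ed d → ℝ} {x : Ed d} (hv : ContDiffAt ℝ 2 v x)
    (hmin : IsLocalMin v x) (ξ : Ed d) : 0 ≤ fderiv ℝ (fderiv ℝ v) x ξ ξ := by
  by_contra hneg
  push Not at hneg
  set f : ℝ → ℝ := fun θ => v (x + θ • ξ) with hf
  have hline : ∀ θ : ℝ, HasDerivAt (fun θ : ℝ => x + θ • ξ) ξ θ := by
    intro θ
    simpa using ((hasDerivAt_id θ).smul_const ξ).const_add x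
  have hcont : Tendsto (fun θ : ℝ => x + θ • ξ) (𝓝 0) (𝓝 x) := by
    have := (hline 0).continuousAt.tendsto
    simpa using this
  have hd1 : ∀ᶠ θ in 𝓝 (0:ℝ), HasDerivAt f (fderiv ℝ v (x + θ • ξ) ξ) θ := by
    have := hcont.eventually (hv.eventually (by simp))
    filter_upwards [this] with θ hθ
    exact (hθ.differentiableAt (by simp)).hasFDerivAt.comp_hasDerivAt θ (hline θ)
  have hderiv : deriv f =ᶠ[𝓝 0] fun θ => fderiv ℝ v (x + θ • ξ) ξ := by
    filter_upwards [hd1] with θ hθ using hθ.deriv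
  have hd2 : HasDerivAt (deriv f) (fderiv ℝ (fderiv ℝ v) x ξ ξ) 0 := by
    refine HasDerivAt.congr_of_eventuallyEq ?_ hderiv
    have h2 : HasFDerivAt (fderiv ℝ v) (fderiv ℝ (fderiv ℝ v) x) (x + (0:ℝ) • ξ) := by
      simpa using ((hv.fderiv_right (m := 1) (by norm_num)).differentiableAt (by simp)).hasFDerivAt
    have h3 := h2.comp_hasDerivAt (0:ℝ) (hline 0)
    have h4 := h3.clm_apply (hasDerivAt_const (0:ℝ) ξ)
    simpa using h4
  have hfd0 : deriv f 0 = 0 := by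
    rw [hderiv.self_of_nhds]
    simp [hmin.fderiv_eq_zero]
  have hmax := isLocalMax_of_deriv_deriv_neg (f := f) (x₀ := 0) (by rw [hd2.deriv]; exact hneg) hfd0
    hd1.self_of_nhds.continuousAt
  have hmin' : IsLocalMin f 0 := by
    have := hcont.eventually hmin
    filter_upwards [this] with θ hθ
    simpa [hf] using hθ
  have hconst : f =ᶠ[𝓝 0] fun _ => f 0 := by
    filter_upwards [hmax, hmin'] with θ h1 h2 using le_antisymm h1 h2
  have h0 : deriv f =ᶠ[𝓝 0] fun _ => 0 := by
    have := hconst.deriv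
    simpa using this
  have := h0.deriv_eq
  rw [hd2.deriv] at this
  simp at this
  linarith

lemma applyA_nonneg_of_isLocalMin {d : ℕ} (q : ℝ → Ed d → Matrix (Fin d) (Fin d) ℝ)
    (b : ℝ → Ed d → Ed d) (t : ℝ) {v : Ed d → ℝ} {x : Ed d} (hsym : (q t x).IsSymm)
    (hpos : ∀ ξ : Ed d, 0 ≤ ∑ i, ∑ j, q t x i j * ξ i * ξ j)
    (hv : ContDiffAt ℝ 2 v x) (hmin : IsLocalMin v x) : 0 ≤ applyA q b t v x := by
  have hpsd : (q t x).PosSemidef := by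
    refine Matrix.PosSemidef.of_dotProduct_mulVec_nonneg ?_ ?_
    · simpa [Matrix.IsHermitian, Matrix.conjTranspose_eq_transpose_of_trivial] using hsym.eq
    · intro ξ
      have := hpos (WithLp.toLp 2 ξ)
      refine this.trans_eq ?_
      simp only [dotProduct, Matrix.mulVec, Finset.mul_sum]
      refine Finset.sum_congr rfl fun i _ => Finset.sum_congr rfl fun j _ => ?_
      simp; ring
  obtain ⟨B, hB⟩ : ∃ B : Matrix (Fin d) (Fin d) ℝ, q t x = B.transpose * B := by
    open scoped MatrixOrder in
    obtain ⟨B, hB⟩ := CStarAlgebra.nonneg_iff_eq_star_mul_self.mp hpsd.nonneg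
    exact ⟨B, by rw [hB, Matrix.star_eq_conjTranspose, Matrix.conjTranspose_eq_transpose_of_trivial]⟩
  rw [applyA_eq, hmin.fderiv_eq_zero]
  simp only [_root_.zero_apply, add_zero]
  have key : ∑ i, ∑ j, q t x i j * fderiv ℝ (fderiv ℝ v) x (EuclideanSpace.single i 1)
      (EuclideanSpace.single j 1) = ∑ k, fderiv ℝ (fderiv ℝ v) x
        (∑ i, B k i • EuclideanSpace.single i 1) (∑ i, B k i • EuclideanSpace.single i 1) := by
    simp only [hB, Matrix.mul_apply, Matrix.transpose_apply, map_sum, map_smul,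
      _root_.sum_apply, _root_.smul_apply, smul_eq_mul, Finset.sum_mul,
      Finset.mul_sum]
    conv_rhs => rw [Finset.sum_comm]
    rw [Finset.sum_comm]
    refine Finset.sum_congr rfl fun i _ => ?_
    rw [Finset.sum_comm]
    refine Finset.sum_congr rfl fun j _ => Finset.sum_congr rfl fun k _ => ?_
    ring
  rw [key]
  exact Finset.sum_nonneg fun k _ => hess_nonneg hv hmin _

/-- Comparison principle on a compact set of space-time. -/
lemma comparison {d : ℕ} (q : ℝ → Ed d → Matrix (Fin d) (Fin d) ℝ)
    (b : ℝ → Ed d → Ed d) (u w : ℝ → Ed d → ℝ) (D : Set (ℝ × Ed d)) (hD : IsCompact D)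
    (hu : ContinuousOn (fun z : ℝ × Ed d => u z.1 z.2) D)
    (hw : ContinuousOn (fun z : ℝ × Ed d => w z.1 z.2) D)
    (t0 : ℝ) (ht0 : ∀ z ∈ D, t0 ≤ z.1)
    (hq : ∀ z ∈ D, (q z.1 z.2).IsSymm ∧
      ∀ ξ : Ed d, 0 ≤ ∑ i, ∑ j, q z.1 z.2 i j * ξ i * ξ j)
    (H : ∀ t x, (t, x) ∈ D → u t x < w t x →
      D ∈ 𝓝[Iic t ×ˢ univ] (t, x) ∧ ContDiffAt ℝ 2 (u t) x ∧ ContDiffAt ℝ 2 (w t) x ∧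
      ∃ u' w', HasDerivAt (fun τ => u τ x) u' t ∧ HasDerivAt (fun τ => w τ x) w' t ∧
        u' = applyA q b t (u t) x ∧ w' ≤ applyA q b t (w t) x) :
    ∀ t x, (t, x) ∈ D → w t x ≤ u t x := by
  intro t x htx
  by_contra hlt
  push Not at hlt
  have htt0 := ht0 _ htx
  set σ : ℝ := (w t x - u t x) / (2 * (t - t0 + 1)) with hσ
  have hpos1 : 0 < t - t0 + 1 := by simp at htt0; linarith
  have hσpos : 0 < σ := div_pos (by linarith) (by linarith)
  have hcont : ContinuousOn (fun z : ℝ × Ed d => u z.1 z.2 - w z.1 z.2 + σ * (z.1 - t0)) D := by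
    refine (hu.sub hw).add ?_
    fun_prop
  obtain ⟨⟨s, y⟩, hsyD, hsymin⟩ := hD.exists_isMinOn ⟨_, htx⟩ hcont
  have hval : u s y - w s y + σ * (s - t0) < 0 := by
    have h1 := hsymin htx
    simp only [mem_ofPred_eq] at h1
    refine lt_of_le_of_lt h1 ?_
    have : σ * (t - t0) ≤ σ * (t - t0 + 1) := by nlinarith
    have h3 : σ * (t - t0 + 1) = (w t x - u t x) / 2 := by
      rw [hσ]; field_simp
    linarith
  have hs0 : t0 ≤ s := ht0 _ hsyD
  have huw : u s y < w s y := by nlinarith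
  obtain ⟨hnhd, hcu, hcw, u', w', hu', hw', hu'A, hw'A⟩ := H s y hsyD huw
  -- space minimum
  have hspace : IsLocalMin (fun z => u s z - w s z) y := by
    have htend : Tendsto (fun z : Ed d => (s, z)) (𝓝 y) (𝓝[Iic s ×ˢ univ] (s, y)) := by
      refine tendsto_nhdsWithin_iff.2 ⟨?_, Eventually.of_forall fun z => by simp⟩
      exact (Continuous.prodMk_right s).tendsto y
    filter_upwards [htend hnhd] with z hz
    have := hsymin hz
    simp only [mem_ofPred_eq] at this
    linarith
  have hA := applyA_nonneg_of_isLocalMin q b s (hq _ hsyD).1 (hq _ hsyD).2 (hcu.sub hcw) hspace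
  rw [applyA_sub q b s hcu hcw] at hA
  -- time derivative
  have htime : u' - w' + σ ≤ 0 := by
    have hder : HasDerivAt (fun τ => u τ y - w τ y + σ * (τ - t0)) (u' - w' + σ) s := by
      have := (hu'.fun_sub hw').fun_add (((hasDerivAt_id s).sub_const t0).const_mul σ)
      exact this.congr_deriv (by simp)
    have htend : Tendsto (fun τ : ℝ => (τ, y)) (𝓝[<] s) (𝓝[Iic s ×ˢ univ] (s, y)) := by
      refine tendsto_nhdsWithin_iff.2 ⟨?_, ?_⟩
      · exact ((Continuous.prodMk_left y).tendsto s).mono_left nhdsWithin_le_nhds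
      · filter_upwards [self_mem_nhdsWithin] with τ hτ
        simp at hτ ⊢
        exact hτ.le
    have hslope := (hasDerivAt_iff_tendsto_slope.1 hder).mono_left
      (nhdsWithin_mono s (show Iio s ⊆ {s}ᶜ from fun τ hτ => ne_of_lt hτ))
    refine le_of_tendsto hslope ?_
    filter_upwards [htend hnhd, self_mem_nhdsWithin] with τ hτ hlt
    have := hsymin hτ
    simp only [mem_ofPred_eq] at this
    rw [slope_def_field]
    refine div_nonpos_of_nonneg_of_nonpos ?_ ?_
    · linarith
    · simp at hlt; linarith
  linarith

lemma cyl_nhds {d : ℕ} {s t t1 R : ℝ} {c x : Ed d} (hst : s < t) (htt : t ≤ t1)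
    (hx : ‖x - c‖ < R) : Icc s t1 ×ˢ closedBall c R ∈ 𝓝[Iic t ×ˢ univ] (t, x) := by
  have hopen : IsOpen (Ioi s ×ˢ ball c R) := isOpen_Ioi.prod isOpen_ball
  have hmem : (t, x) ∈ Ioi s ×ˢ ball c R := ⟨hst, by simpa [mem_ball, dist_eq_norm] using hx⟩
  filter_upwards [mem_nhdsWithin_of_mem_nhds (hopen.mem_nhds hmem), self_mem_nhdsWithin] with z h1 h2
  exact ⟨⟨(le_of_lt h1.1 : s ≤ z.1), le_trans (h2.1 : z.1 ≤ t) htt⟩, ball_subset_closedBall h1.2⟩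

lemma applyA_affine {d : ℕ} (q : ℝ → Ed d → Matrix (Fin d) (Fin d) ℝ) (b : ℝ → Ed d → Ed d)
    (t : ℝ) {u : Ed d → ℝ} (x : Ed d) (hu : ContDiff ℝ 2 u) (c k : ℝ) :
    applyA q b t (fun y => c * u y + k) x = c * applyA q b t u x := by
  have h1 : fderiv ℝ (fun y => c * u y + k) = fun y => c • fderiv ℝ u y := by
    ext1 y
    rw [fderiv_add_const, fderiv_const_mul (hu.differentiable (by simp) y)]
  have h2 : fderiv ℝ (fun y => c • fderiv ℝ u y) x = c • fderiv ℝ (fderiv ℝ u) x := by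
    have h3 : DifferentiableAt ℝ (fderiv ℝ u) x :=
      (hu.fderiv_right (m := 1) (by norm_num)).differentiable (by simp) x
    exact (h3.hasFDerivAt.const_smul c).fderiv
  simp only [applyA_eq, h1, h2, _root_.smul_apply, smul_eq_mul, mul_add, Finset.mul_sum]
  congr 1
  refine Finset.sum_congr rfl fun i _ => Finset.sum_congr rfl fun j _ => ?_
  ring

lemma Hypotheses.psd {d : ℕ} (H : Hypotheses d) {t : ℝ} (ht : 0 ≤ t) (x ξ : Ed d) :
    0 ≤ ∑ i, ∑ j, H.q t x i j * ξ i * ξ j := by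
  refine le_trans ?_ (H.ellipticity t ht x ξ)
  have h1 := H.η_lb t ht x
  have h2 := H.hη₀
  exact mul_nonneg (by linarith) (by positivity)

lemma Hypotheses.G_nonneg {d : ℕ} (H : Hypotheses d) {s : ℝ} (hs : 0 ≤ s) {f : Ed d → ℝ}
    (hf : IsCb f) (hf0 : ∀ x, 0 ≤ f x) : ∀ t, s ≤ t → ∀ x, 0 ≤ H.G t s f x := by
  intro t1 ht1 x1
  have sol := H.G_sol s hs f hf
  obtain ⟨M, hM⟩ := sol.bdd
  have key : ∀ ε > 0, -ε * (H.V x1 + H.a * (t1 - s)) ≤ H.G t1 s f x1 := by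
    intro ε hε
    have hV : ∀ᶠ r : ℝ in atTop, ∀ x : Ed d, r ≤ ‖x‖ → M / ε < H.V x := by
      have := H.V_tendsto.eventually (eventually_gt_atTop (M / ε))
      rw [eventually_comap] at this
      obtain ⟨r0, hr0⟩ := eventually_atTop.1 this
      filter_upwards [eventually_ge_atTop r0] with r hr x hx
      exact hr0 ‖x‖ (hr.trans hx) x rfl
    obtain ⟨R, hRV, hR1⟩ := (hV.and (eventually_ge_atTop ‖x1‖)).exists
    refine comparison H.q H.b (fun t => H.G t s f)
      (fun t x => -ε * (H.V x + H.a * (t - s))) (Icc s t1 ×ˢ closedBall 0 R)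
      (isCompact_Icc.prod (isCompact_closedBall _ _)) ?_ ?_ s ?_ ?_ ?_ t1 x1 ?_
    · exact sol.cont.mono (prod_mono Icc_subset_Ici_self (subset_univ _))
    · have := H.V_C2.continuous
      fun_prop
    · rintro z ⟨hz, -⟩; exact hz.1
    · rintro z ⟨hz, -⟩
      exact ⟨H.q_symm _ (hs.trans hz.1) _, H.psd (hs.trans hz.1) _⟩
    · rintro t x ⟨⟨ht, ht'⟩, hx⟩ hlt
      simp only at ht ht' hlt
      have hVx := H.V_pos x
      have hlast : 0 ≤ H.a * (t - s) := mul_nonneg H.ha (by linarith)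
      have hts : s < t := by
        rcases ht.lt_or_eq with h | h
        · exact h
        · subst h
          rw [sol.init x] at hlt
          have := hf0 x
          have : 0 < ε * (H.V x + H.a * (s - s)) := by positivity
          linarith
      have hxR : ‖x‖ < R := by
        by_contra hcon
        push Not at hcon
        have h1 := hRV x hcon
        rw [div_lt_iff₀ hε] at h1
        have h2 := (abs_le.1 (hM t ht x)).1
        nlinarith
      refine ⟨cyl_nhds hts ht' (by simpa using hxR), (sol.smooth_space t hts).contDiffAt, ?_, ?_⟩
      · have := H.V_C2
        exact (contDiff_const.mul (this.add contDiff_const)).contDiffAt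
      · refine ⟨_, -ε * H.a, sol.pde t hts x, ?_, rfl, ?_⟩
        · have := (((hasDerivAt_id t).sub_const s).const_mul H.a).const_add (H.V x)
          exact (this.const_mul (-ε)).congr_deriv (by simp)
        · have heq : (fun x => -ε * (H.V x + H.a * (t - s)))
              = fun x => -ε * H.V x + (-ε * (H.a * (t - s))) := by ext y; ring
          simp only [heq]
          rw [applyA_affine _ _ _ _ H.V_C2]
          have h1 := H.lyapunov t (hs.trans ht) x
          have h2 := mul_pos H.hκ hVx
          nlinarith
    · exact ⟨⟨ht1, le_rfl⟩, by simpa using hR1⟩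
  have hlim : Tendsto (fun ε : ℝ => -ε * (H.V x1 + H.a * (t1 - s))) (𝓝[>] 0) (𝓝 0) := by
    have : Continuous (fun ε : ℝ => -ε * (H.V x1 + H.a * (t1 - s))) := by fun_prop
    have h := (this.tendsto 0).mono_left (nhdsWithin_le_nhds (s := Ioi 0))
    simpa using h
  refine le_of_tendsto hlim ?_
  filter_upwards [self_mem_nhdsWithin] with ε hε using key ε hε

/-- Action of the operator on a function of a quadratic form. -/
lemma quad_jets {d : ℕ} (T : Ed d →L[ℝ] Ed d) (hT : ∀ v w, ⟪T v, w⟫ = ⟪v, T w⟫) (ξ : Ed d)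
    (g g' g'' : ℝ → ℝ) (hg : ∀ σ, HasDerivAt g (g' σ) σ) (hg' : ∀ σ, HasDerivAt g' (g'' σ) σ)
    (q : ℝ → Ed d → Matrix (Fin d) (Fin d) ℝ) (b : ℝ → Ed d → Ed d) (t : ℝ) (x : Ed d) :
    applyA q b t (fun y => g ⟪T (y - ξ), y - ξ⟫) x =
      g' ⟪T (x - ξ), x - ξ⟫ * (2 * (∑ i, ∑ j, q t x i j * T (EuclideanSpace.single i 1) j)
        + 2 * ⟪T (x - ξ), b t x⟫)
      + g'' ⟪T (x - ξ), x - ξ⟫ * (4 * ∑ i, ∑ j, q t x i j * T (x - ξ) i * T (x - ξ) j) := by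
  have hS : ∀ y, HasFDerivAt (fun y => ⟪T (y - ξ), y - ξ⟫) (2 • innerSL ℝ (T (y - ξ))) y := by
    intro y
    have h1 : HasFDerivAt (fun y => y - ξ) (ContinuousLinearMap.id ℝ (Ed d)) y :=
      (hasFDerivAt_id y).sub_const ξ
    have h2 : HasFDerivAt (fun y => T (y - ξ)) T y := by
      exact (T.hasFDerivAt (x := y - ξ)).comp y h1
    refine (h2.inner ℝ h1).congr_fderiv ?_
    ext v
    have h3 := hT v (y - ξ)
    have h4 := real_inner_comm (T (y - ξ)) v
    simp only [ContinuousLinearMap.comp_apply, ContinuousLinearMap.prod_apply,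
      fderivInnerCLM_apply, ContinuousLinearMap.id_apply, _root_.smul_apply, innerSL_apply_apply,
      nsmul_eq_mul, Nat.cast_ofNat]
    linarith
  have hu : ∀ y, HasFDerivAt (fun y => g ⟪T (y - ξ), y - ξ⟫)
      (g' ⟪T (y - ξ), y - ξ⟫ • (2 • innerSL ℝ (T (y - ξ)))) y := fun y =>
    (hg _).comp_hasFDerivAt y (hS y)
  have hfd : fderiv ℝ (fun y => g ⟪T (y - ξ), y - ξ⟫)
      = fun y => g' ⟪T (y - ξ), y - ξ⟫ • (2 • innerSL ℝ (T (y - ξ))) := by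
    ext1 y; exact (hu y).fderiv
  have hlin : HasFDerivAt (fun y => (2:ℕ) • innerSL ℝ (T (y - ξ)))
      ((2:ℕ) • ((innerSL ℝ : Ed d →L[ℝ] _).comp T)) x := by
    have h1 : HasFDerivAt (fun y => y - ξ) (ContinuousLinearMap.id ℝ (Ed d)) x :=
      (hasFDerivAt_id x).sub_const ξ
    have h2 := ((innerSL ℝ : Ed d →L[ℝ] _).comp T).hasFDerivAt (x := x - ξ)
    have h3 := (h2.comp x h1).const_smul (2:ℕ)
    exact h3
  have hff : HasFDerivAt (fun y => g' ⟪T (y - ξ), y - ξ⟫ • ((2:ℕ) • innerSL ℝ (T (y - ξ)))) _ x :=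
    ((hg' _).comp_hasFDerivAt x (hS x)).smul hlin
  simp only [applyA_eq, hfd]
  rw [hff.fderiv]
  simp [Finset.sum_add_distrib, mul_add, Finset.mul_sum, EuclideanSpace.inner_single_right,
    -map_sub]
  rw [add_right_comm]
  congr 1
  · congr 1
    refine Finset.sum_congr rfl fun i _ => Finset.sum_congr rfl fun j _ => ?_
    ring
  · refine Finset.sum_congr rfl fun i _ => Finset.sum_congr rfl fun j _ => ?_
    ring

lemma Hypotheses.b_mono {d : ℕ} (H : Hypotheses d) {t : ℝ} (ht : 0 ≤ t) (x y : Ed d) :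
    ⟪H.b t x - H.b t y, x - y⟫ ≤ H.r₀ * ‖x - y‖ ^ 2 := by
  have hline : ∀ θ : ℝ, HasDerivAt (fun θ : ℝ => y + θ • (x - y)) (x - y) θ := by
    intro θ
    simpa using ((hasDerivAt_id θ).smul_const (x - y)).const_add y
  have hd : ∀ θ : ℝ, HasDerivAt (fun θ : ℝ => ⟪H.b t (y + θ • (x - y)), x - y⟫)
      ⟪fderiv ℝ (H.b t) (y + θ • (x - y)) (x - y), x - y⟫ θ := by
    intro θ
    have h1 := ((H.b_diff t ht (y + θ • (x - y))).hasFDerivAt.comp_hasDerivAt θ (hline θ))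
    have h2 := h1.inner ℝ (hasDerivAt_const θ (x - y))
    simpa using h2
  have := (convex_univ).image_sub_le_mul_sub_of_deriv_le (D := (univ : Set ℝ))
    (f := fun θ : ℝ => ⟪H.b t (y + θ • (x - y)), x - y⟫) (C := H.r₀ * ‖x - y‖ ^ 2)
    (fun θ _ => (hd θ).continuousAt.continuousWithinAt)
    (fun θ _ => (hd θ).differentiableAt.differentiableWithinAt)
    (fun θ _ => by rw [(hd θ).deriv]; exact H.b_dissip t ht _ _) 0 (mem_univ _) 1 (mem_univ _)
    zero_le_one
  simpa [inner_sub_left] using this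

lemma norm_le_sum_abs {d : ℕ} (v : Ed d) : ‖v‖ ≤ ∑ j, |v j| := by
  have h1 : v = ∑ j, v j • EuclideanSpace.single j (1:ℝ) := by
    ext i
    simp [Finset.sum_apply, Pi.single_apply]
  calc ‖v‖ = ‖∑ j, v j • EuclideanSpace.single j (1:ℝ)‖ := by rw [← h1]
    _ ≤ ∑ j, ‖v j • EuclideanSpace.single j (1:ℝ)‖ := norm_sum_le _ _
    _ = ∑ j, |v j| := by simp [norm_smul]

/-- The drift is locally bounded, uniformly in time. -/
lemma Hypotheses.b_bdd {d : ℕ} (H : Hypotheses d) {R : ℝ} (hR : 0 < R) :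
    ∃ B : ℝ, 0 < B ∧ ∀ t, 0 ≤ t → ∀ x : Ed d, ‖x‖ ≤ R → ‖H.b t x‖ ≤ B := by
  obtain ⟨p, hp, hIntg⟩ := H.int_bdd
  obtain ⟨M, hM⟩ := hIntg (R + 2) (by linarith)
  have hp1 : 1 ≤ p := by
    have : (0:ℝ) ≤ d := Nat.cast_nonneg d
    linarith
  set W : ℝ := volume.real (ball (0 : Ed d) (1/2)) with hW
  have hWpos : 0 < W := by
    rw [hW, Measure.real, ENNReal.toReal_pos_iff]
    exact ⟨measure_ball_pos _ _ (by norm_num), measure_ball_lt_top⟩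
  set C : ℝ := ∑ j : Fin d, (volume.real (ball (0 : Ed d) (R+2)) + |M|) with hC
  have hC0 : 0 ≤ C := Finset.sum_nonneg fun j _ => by positivity
  -- the key claim
  have claim : ∀ t, 0 ≤ t → ∀ x : Ed d, ‖x‖ ≤ R →
      ‖H.r₀ • x - H.b t x‖ ≤ 3 * ((C + 1) / W + |H.r₀| * (R + 2)) := by
    intro t ht x hx
    by_contra hcon
    push Not at hcon
    set m := ‖H.r₀ • x - H.b t x‖ with hm
    have hm0 : 0 < m := lt_of_le_of_lt (by positivity) hcon
    set e : Ed d := m⁻¹ • (H.r₀ • x - H.b t x) with he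
    have hBe : H.r₀ • x - H.b t x = m • e := by
      rw [he, smul_smul, mul_inv_cancel₀ hm0.ne', one_smul]
    have hen : ‖e‖ = 1 := by
      rw [he, norm_smul, norm_inv, ← hm, Real.norm_of_nonneg hm0.le, inv_mul_cancel₀ hm0.ne']
    have hsub : ball (x + e) (1/2) ⊆ ball (0 : Ed d) (R + 2) := by
      intro y hy
      rw [mem_ball, dist_eq_norm] at hy
      rw [mem_ball_zero_iff]
      have h1 : ‖y‖ ≤ ‖y - (x + e)‖ + ‖x + e‖ := by
        simpa using norm_add_le (y - (x + e)) (x + e)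
      have := norm_add_le x e
      linarith
    have hlow : ∀ y ∈ ball (x + e) (1/2), (C + 1) / W < ∑ j, |H.b t y j| := by
      intro y hy
      have hyR := hsub hy
      rw [mem_ball_zero_iff] at hyR
      rw [mem_ball, dist_eq_norm] at hy
      have hmono := H.b_mono ht y x
      set v := y - (x + e) with hv
      have hyx : y - x = e + v := by rw [hv]; abel
      have h1 : ⟪H.r₀ • x - H.b t x, y - x⟫ ≤ ⟪H.r₀ • y - H.b t y, y - x⟫ := by
        have h2 : H.r₀ • y - H.b t y - (H.r₀ • x - H.b t x)
            = H.r₀ • (y - x) - (H.b t y - H.b t x) := by rw [smul_sub]; abel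
        have h3 : ⟪H.r₀ • y - H.b t y - (H.r₀ • x - H.b t x), y - x⟫
            = H.r₀ * ‖y - x‖ ^ 2 - ⟪H.b t y - H.b t x, y - x⟫ := by
          rw [h2, inner_sub_left, real_inner_smul_left, real_inner_self_eq_norm_sq]
        rw [inner_sub_left] at h3
        linarith
      have h4 : ⟪H.r₀ • x - H.b t x, y - x⟫ ≥ m / 2 := by
        rw [hBe, hyx, real_inner_smul_left, inner_add_right, real_inner_self_eq_norm_sq, hen]
        have := (abs_le.1 (abs_real_inner_le_norm e v)).1
        rw [hen] at this
        nlinarith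
      have h5 : ⟪H.r₀ • y - H.b t y, y - x⟫ ≤ ‖H.r₀ • y - H.b t y‖ * (3/2) := by
        refine (real_inner_le_norm _ _).trans ?_
        refine mul_le_mul_of_nonneg_left ?_ (norm_nonneg _)
        rw [hyx]
        have := norm_add_le e v
        linarith
      have h6 : ‖H.r₀ • y - H.b t y‖ ≤ |H.r₀| * (R + 2) + ‖H.b t y‖ := by
        refine (norm_sub_le _ _).trans ?_
        rw [norm_smul, Real.norm_eq_abs]
        gcongr
      have h7 := norm_le_sum_abs (H.b t y)
      linarith
    have hcb : ∀ j, Continuous fun y => |H.b t y j| := by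
      intro j
      have := (H.b_diff t ht).continuous
      fun_prop
    have hintg : ∀ j, IntegrableOn (fun y => |H.b t y j|) (ball (0 : Ed d) (R+2)) := fun j =>
      ((hcb j).continuousOn.integrableOn_compact (isCompact_closedBall 0 (R+2))).mono_set
        ball_subset_closedBall
    have hintp : ∀ j, IntegrableOn (fun y => |H.b t y j| ^ p) (ball (0 : Ed d) (R+2)) := fun j =>
      (((hcb j).rpow_const fun y => Or.inr (by linarith)).continuousOn.integrableOn_compact
        (isCompact_closedBall 0 (R+2))).mono_set ball_subset_closedBall
    have : IsFiniteMeasure (volume.restrict (ball (0 : Ed d) (R + 2))) :=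
      ⟨by rw [Measure.restrict_apply_univ]; exact measure_ball_lt_top⟩
    have hup : ∫ y in ball (x + e) (1/2), ∑ j, |H.b t y j| ≤ C := by
      rw [integral_finsetSum _ fun j _ => (hintg j).mono_set hsub, hC]
      refine Finset.sum_le_sum fun j _ => ?_
      calc ∫ y in ball (x + e) (1/2), |H.b t y j|
          ≤ ∫ y in ball (0 : Ed d) (R+2), |H.b t y j| :=
            setIntegral_mono_set (hintg j) (Eventually.of_forall fun y => abs_nonneg _)
              (Eventually.of_forall hsub)
        _ ≤ ∫ y in ball (0 : Ed d) (R+2), (1 + |H.b t y j| ^ p) := by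
            refine integral_mono (hintg j) ((integrable_const _).add (hintp j)) fun y => ?_
            simp only
            rcases le_total (|H.b t y j|) 1 with h | h
            · have : 0 ≤ |H.b t y j| ^ p := by positivity
              linarith
            · have := Real.self_le_rpow_of_one_le h hp1
              linarith
        _ = volume.real (ball (0 : Ed d) (R+2)) + ∫ y in ball (0 : Ed d) (R+2), |H.b t y j| ^ p := by
            rw [integral_add (integrable_const _) (hintp j)]
            simp
        _ ≤ _ := by
            have := (hM t ht j j).2
            have := le_abs_self M
            linarith
    have hlo : C + 1 ≤ ∫ y in ball (x + e) (1/2), ∑ j, |H.b t y j| := by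
      have hvol : volume.real (ball (x + e) (1/2)) = W := by
        rw [hW, Measure.real, Measure.real, Measure.addHaar_ball_center]
      have h1 : ∫ y in ball (x + e) (1/2), ((C + 1) / W) = C + 1 := by
        rw [setIntegral_const, hvol, smul_eq_mul]
        field_simp
      rw [← h1]
      have : IsFiniteMeasure (volume.restrict (ball (x + e) (1/2))) :=
        ⟨by rw [Measure.restrict_apply_univ]; exact measure_ball_lt_top⟩
      refine setIntegral_mono_on (integrable_const _)
        (integrable_finsetSum _ fun j _ => (hintg j).mono_set hsub) measurableSet_ball
        fun y hy => (hlow y hy).le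
    linarith
  refine ⟨3 * ((C + 1) / W + |H.r₀| * (R + 2)) + |H.r₀| * R + 1, by positivity, fun t ht x hx => ?_⟩
  have h1 := claim t ht x hx
  have h2 : ‖H.b t x‖ ≤ ‖H.r₀ • x‖ + ‖H.r₀ • x - H.b t x‖ := by
    have := norm_sub_le (H.r₀ • x) (H.r₀ • x - H.b t x)
    simpa using this
  rw [norm_smul, Real.norm_eq_abs] at h2
  have : |H.r₀| * ‖x‖ ≤ |H.r₀| * R := by gcongr
  linarith

/-- The diffusion coefficients are locally bounded and Lipschitz, uniformly in time. -/
lemma Hypotheses.q_lip {d : ℕ} (H : Hypotheses d) {R : ℝ} (hR : 0 < R) :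
    ∃ M : ℝ, 0 < M ∧ (∀ t, 0 ≤ t → ∀ x : Ed d, ‖x‖ < R → ∀ i j, |H.q t x i j| ≤ M) ∧
    ∃ L : ℝ, 0 < L ∧ ∀ t, 0 ≤ t → ∀ x y : Ed d, ‖x‖ < R → ‖y‖ < R → ∀ i j,
      |H.q t x i j - H.q t y i j| ≤ L * ‖x - y‖ := by
  obtain ⟨M, hM⟩ := H.q_bdd R hR
  have hM' : ∀ t, 0 ≤ t → ∀ x : Ed d, ‖x‖ < R → ∀ i j, |H.q t x i j| ≤ |M| + 1 := by
    intro t ht x hx i j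
    have := hM t ht x (by simpa using hx) i j
    have := le_abs_self M
    linarith
  refine ⟨|M| + 1, by positivity, hM', H.c₀ * (|M| + 1) + 1, ?_, ?_⟩
  · have := H.hc₀
    positivity
  · intro t ht x y hx hy i j
    have hgrad : ∀ z : Ed d, ‖z‖ < R →
        ‖fderiv ℝ (fun z => H.q t z i j) z‖ ≤ H.c₀ * (|M| + 1) + 1 := by
      intro z hz
      have h1 : ‖fderiv ℝ (fun z => H.q t z i j) z‖ = ‖gradient (fun z => H.q t z i j) z‖ := by
        simp [gradient]
      rw [h1]
      have h2 : ‖gradient (fun z => H.q t z i j) z‖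
          ≤ Real.sqrt (∑ i, ∑ j, ‖gradient (fun z => H.q t z i j) z‖ ^ 2) := by
        refine Real.le_sqrt_of_sq_le ?_
        refine le_trans ?_ (Finset.single_le_sum (f := fun i => ∑ j, ‖gradient (fun z => H.q t z i j) z‖ ^ 2)
          (fun i _ => Finset.sum_nonneg fun j _ => by positivity) (Finset.mem_univ i))
        exact Finset.single_le_sum (f := fun j => ‖gradient (fun z => H.q t z i j) z‖ ^ 2)
          (fun i _ => by positivity) (Finset.mem_univ j)
      have h3 := H.gradQ_bdd t ht z
      have h4 : H.η t z ≤ |M| + 1 := by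
        have h5 := H.ellipticity t ht z (EuclideanSpace.single i 1)
        simp at h5
        exact h5.trans ((le_abs_self _).trans (hM' t ht z hz i i))
      have h6 := mul_le_mul_of_nonneg_left h4 H.hc₀
      linarith
    have := (convex_ball (0 : Ed d) R).norm_image_sub_le_of_norm_fderiv_le (𝕜 := ℝ)
      (f := fun z => H.q t z i j) (C := H.c₀ * (|M| + 1) + 1)
      (fun z _ => H.q_diff t ht i j z) (fun z hz => hgrad z (by simpa using hz))
      (show y ∈ ball (0 : Ed d) R by simpa using hy) (show x ∈ ball (0 : Ed d) R by simpa using hx)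
    simpa using this

lemma expand_arith {K h η r R D M B A1 A2 bb xx : ℝ} (hh0 : 0 ≤ h)
    (htr : A1 ≤ D * M) (hbb : bb ≤ r * B) (hxx : xx ≤ r * (2 * R)) (hell : η * (r ^ 2 - h) ≤ A2)
    (hdisc : 0 ≤ K * h ^ 2 - (8 * r * R + 4 * (D * M + r * B) + 8 * η) * h + 8 * η * r ^ 2) :
    -K * h ^ 2 + 4 * h * xx ≤ -2 * h * (2 * A1 + 2 * bb) + 2 * (4 * A2) := by
  have e1 := mul_le_mul_of_nonneg_left htr hh0
  have e2 := mul_le_mul_of_nonneg_left hbb hh0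
  have e3 := mul_le_mul_of_nonneg_left hxx hh0
  linarith

/-- Expansion of positivity. -/
lemma Hypotheses.expand {d : ℕ} (H : Hypotheses d) {R r : ℝ} (hR : 0 < R) (hr : 0 < r) :
    ∃ c : ℝ, 0 < c ∧ ∀ s, 0 ≤ s → ∀ f, IsCb f → (∀ x, 0 ≤ f x) → ∀ t0, s ≤ t0 → ∀ x0 x1 : Ed d,
      ‖x0‖ ≤ R → ‖x1‖ ≤ R → ∀ m, 0 ≤ m → (∀ x, ‖x - x0‖ ≤ r → m ≤ H.G t0 s f x) →
      c * m ≤ H.G (t0 + 1) s f x1 := by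
  obtain ⟨B, hB, hbB⟩ := H.b_bdd (R := R + r + 1) (by linarith)
  obtain ⟨M, hM, hqM, -⟩ := H.q_lip (R := R + r + 1) (by linarith)
  have hη := H.hη₀
  set C2 : ℝ := 8 * r * R + 4 * (d * M + r * B) + 8 * H.η₀ with hC2
  set K : ℝ := C2 ^ 2 / (32 * H.η₀ * r ^ 2) with hK
  refine ⟨Real.exp (-K), Real.exp_pos _, ?_⟩
  intro s hs f hf hf0 t0 hst0 x0 x1 hx0 hx1 m hm hmu
  have sol := H.G_sol s hs f hf
  have hu0 := H.G_nonneg hs hf hf0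
  set ξ : ℝ → Ed d := fun t => x0 + (t - t0) • (x1 - x0) with hξ
  have hξc : Continuous ξ := by fun_prop
  have hξR : ∀ t ∈ Icc t0 (t0 + 1), ‖ξ t‖ ≤ R := by
    intro t ht
    have h1 : ξ t = (1 - (t - t0)) • x0 + (t - t0) • x1 := by
      simp only [hξ]; module
    rw [h1]
    refine (norm_add_le _ _).trans ?_
    rw [norm_smul, norm_smul, Real.norm_of_nonneg (by linarith [ht.2]),
      Real.norm_of_nonneg (by linarith [ht.1])]
    nlinarith [ht.1, ht.2]
  set k : ℝ → ℝ := fun t => m / r ^ 4 * Real.exp (-K * (t - t0)) with hk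
  have hk0 : ∀ t, 0 ≤ k t := fun t => by positivity
  set w : ℝ → Ed d → ℝ := fun t x => k t * (r ^ 2 - ⟪x - ξ t, x - ξ t⟫) ^ 2 with hw
  set D : Set (ℝ × Ed d) := {z | z.1 ∈ Icc t0 (t0 + 1) ∧ ‖z.2 - ξ z.1‖ ≤ r} with hDdef
  have hD : IsCompact D := by
    have : D = (fun z : ℝ × Ed d => (z.1, ξ z.1 + z.2)) '' (Icc t0 (t0 + 1) ×ˢ closedBall 0 r) := by
      ext ⟨t, x⟩
      constructor
      · rintro ⟨h1, h2⟩
        exact ⟨(t, x - ξ t), ⟨h1, by simpa using h2⟩, by simp⟩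
      · rintro ⟨⟨t', v⟩, ⟨h1, h2⟩, h3⟩
        simp only [Prod.mk.injEq] at h3
        obtain ⟨rfl, rfl⟩ := h3
        exact ⟨h1, by simpa using h2⟩
    rw [this]
    exact (isCompact_Icc.prod (isCompact_closedBall _ _)).image (by fun_prop)
  have main := comparison H.q H.b (fun t => H.G t s f) w D hD ?_ ?_ t0 ?_ ?_ ?_ (t0 + 1) x1 ?_
  · refine le_trans (le_of_eq ?_) main
    have : ξ (t0 + 1) = x1 := by simp [hξ]
    simp only [hw, hk, this]
    simp
    field_simp
  · exact sol.cont.mono fun z hz => ⟨hst0.trans hz.1.1, mem_univ _⟩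
  · have : Continuous fun z : ℝ × Ed d => w z.1 z.2 := by
      simp only [hw, hk]; fun_prop
    exact this.continuousOn
  · exact fun z hz => hz.1.1
  · intro z hz
    have : 0 ≤ z.1 := hs.trans (hst0.trans hz.1.1)
    exact ⟨H.q_symm _ this _, H.psd this _⟩
  · rintro t x ⟨⟨ht, ht'⟩, hx⟩ hlt
    simp only at ht ht' hx hlt
    have ht0 : 0 ≤ t := hs.trans (hst0.trans ht)
    set y := x - ξ t with hy
    have hyy : ⟪y, y⟫ = ‖y‖ ^ 2 := real_inner_self_eq_norm_sq y
    have hwpos : 0 < w t x := lt_of_le_of_lt (hu0 t (hst0.trans ht) x) hlt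
    have hyr : ‖y‖ < r := by
      rcases hx.lt_or_eq with h | h
      · exact h
      · exfalso
        simp only [hw, ← hy, hyy, h] at hwpos
        simp at hwpos
    have htt0 : t0 < t := by
      rcases ht.lt_or_eq with h | h
      · exact h
      · exfalso
        subst h
        have h1 : ξ t0 = x0 := by simp [hξ]
        have h2 := hmu x (by rw [← h1]; exact hx)
        have h3 : w t0 x ≤ m := by
          simp only [hw, hk, ← hy, hyy, sub_self, mul_zero, Real.exp_zero, mul_one]
          have h5 : (r ^ 2 - ‖y‖ ^ 2) ^ 2 ≤ (r ^ 2) ^ 2 := by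
            apply pow_le_pow_left₀ _ (by nlinarith [norm_nonneg y])
            nlinarith [norm_nonneg y]
          calc m / r ^ 4 * (r ^ 2 - ‖y‖ ^ 2) ^ 2 ≤ m / r ^ 4 * (r ^ 2) ^ 2 := by gcongr
            _ = m := by field_simp
        linarith
    have hst : s < t := lt_of_le_of_lt hst0 htt0
    refine ⟨?_, (sol.smooth_space t hst).contDiffAt, ?_, ?_⟩
    · have hopen : IsOpen {z : ℝ × Ed d | t0 < z.1 ∧ ‖z.2 - ξ z.1‖ < r} :=
        (isOpen_lt continuous_const continuous_fst).inter
          (isOpen_lt (f := fun z : ℝ × Ed d => ‖z.2 - ξ z.1‖) (by fun_prop) continuous_const)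
      have hmem : (t, x) ∈ {z : ℝ × Ed d | t0 < z.1 ∧ ‖z.2 - ξ z.1‖ < r} := ⟨htt0, hyr⟩
      filter_upwards [mem_nhdsWithin_of_mem_nhds (hopen.mem_nhds hmem), self_mem_nhdsWithin]
        with z h1 h2
      exact ⟨⟨h1.1.le, le_trans (h2.1 : z.1 ≤ t) ht'⟩, h1.2.le⟩
    · have : ContDiff ℝ 2 (w t) := by
        simp only [hw]
        have h0 : ContDiff ℝ 2 fun x : Ed d => x - ξ t := by fun_prop
        exact contDiff_const.mul ((contDiff_const.sub (h0.inner ℝ h0)).pow 2)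
      exact this.contDiffAt
    · have hξ' : HasDerivAt ξ (x1 - x0) t := by
        have := (((hasDerivAt_id t).sub_const t0).smul_const (x1 - x0)).const_add x0
        exact this.congr_deriv (by simp)
      have hS : HasDerivAt (fun τ => ⟪x - ξ τ, x - ξ τ⟫) (-2 * ⟪y, x1 - x0⟫) t := by
        have h1 := hξ'.const_sub x
        refine (h1.inner ℝ h1).congr_deriv ?_
        rw [← hy, inner_neg_left, inner_neg_right, real_inner_comm y (x1 - x0)]
        ring
      have hkd : HasDerivAt k (-K * k t) t := by
        have h1 := (((hasDerivAt_id t).sub_const t0).const_mul (-K)).exp.const_mul (m / r ^ 4)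
        refine h1.congr_deriv ?_
        simp [hk]; ring
      have hwd := hkd.mul ((hS.const_sub (r ^ 2)).pow 2)
      refine ⟨_, _, sol.pde t hst x, hwd, rfl, ?_⟩
      have hquad := quad_jets (ContinuousLinearMap.id ℝ (Ed d)) (fun v w => rfl) (ξ t)
        (fun σ => k t * (r ^ 2 - σ) ^ 2) (fun σ => k t * (-2 * (r ^ 2 - σ))) (fun σ => k t * 2)
        (fun σ => by
          have := (((hasDerivAt_id σ).const_sub (r ^ 2)).pow 2).const_mul (k t)
          refine this.congr_deriv ?_
          simp)
        (fun σ => by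
          have := (((hasDerivAt_id σ).const_sub (r ^ 2)).const_mul (-2)).const_mul (k t)
          refine this.congr_deriv ?_
          simp) H.q H.b t x
      simp only [ContinuousLinearMap.id_apply, ← hy] at hquad
      have hquad' : applyA H.q H.b t (w t) x = _ := hquad
      rw [hquad']
      have hxR : ‖x‖ ≤ R + r := by
        have h1 : ‖x‖ ≤ ‖y‖ + ‖ξ t‖ := by simpa [hy] using norm_add_le (x - ξ t) (ξ t)
        have := hξR t ⟨ht, ht'⟩
        linarith
      have htr : ∑ i, ∑ j, H.q t x i j * (EuclideanSpace.single i (1:ℝ) : Ed d) j ≤ d * M := by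
        have : ∀ i ∈ (Finset.univ : Finset (Fin d)),
            ∑ j, H.q t x i j * (EuclideanSpace.single i (1:ℝ) : Ed d) j ≤ M := by
          intro i _
          simp
          exact (le_abs_self _).trans (hqM t ht0 x (by linarith) i i)
        have h2 := Finset.sum_le_card_nsmul _ _ _ this
        simpa using h2
      have hbb : ⟪y, H.b t x⟫ ≤ r * B := by
        refine (real_inner_le_norm _ _).trans ?_
        have := hbB t ht0 x (by linarith)
        gcongr
      have hxx : ⟪y, x1 - x0⟫ ≤ r * (2 * R) := by
        refine (real_inner_le_norm _ _).trans ?_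
        have := norm_sub_le x1 x0
        gcongr
        linarith
      have hell := H.ellipticity t ht0 x y
      have hell2 : H.η₀ * ‖y‖ ^ 2 ≤ ∑ i, ∑ j, H.q t x i j * y i * y j :=
        le_trans (by have := H.η_lb t ht0 x; gcongr) hell
      set A1 := ∑ i, ∑ j, H.q t x i j * (EuclideanSpace.single i (1:ℝ) : Ed d) j
      set A2 := ∑ i, ∑ j, H.q t x i j * y i * y j
      simp only [← hy, hyy]
      set h := r ^ 2 - ‖y‖ ^ 2 with hh
      have hh0 : 0 ≤ h := by nlinarith [norm_nonneg y]
      have hdisc : 0 ≤ K * h ^ 2 - C2 * h + 8 * H.η₀ * r ^ 2 := by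
        have : K * h ^ 2 - C2 * h + 8 * H.η₀ * r ^ 2
            = (C2 * h - 16 * H.η₀ * r ^ 2) ^ 2 / (32 * H.η₀ * r ^ 2) := by
          rw [hK]; field_simp; ring
        rw [this]; positivity
      have hy2 : ‖y‖ ^ 2 = r ^ 2 - h := by rw [hh]; ring
      rw [hy2] at hell2
      have hfin : -K * h ^ 2 + 4 * h * ⟪y, x1 - x0⟫ ≤
          -2 * h * (2 * A1 + 2 * ⟪y, H.b t x⟫) + 2 * (4 * A2) := by
        exact expand_arith hh0 htr hbb hxx hell2 (by rw [← hC2]; exact hdisc)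
      have := mul_le_mul_of_nonneg_left hfin (hk0 t)
      simp only [Nat.cast_ofNat]
      calc _ = k t * (-K * h ^ 2 + 4 * h * ⟪y, x1 - x0⟫) := by simp [← hy, ← hh]; ring
        _ ≤ _ := this
        _ = _ := by ring
  · exact ⟨⟨by linarith, le_rfl⟩, by simp [hξ, hr.le]⟩

lemma hasDerivAt_det {d : ℕ} {P : ℝ → Matrix (Fin d) (Fin d) ℝ} {Q : Matrix (Fin d) (Fin d) ℝ}
    {t : ℝ} (hP : ∀ i j, HasDerivAt (fun s => P s i j) (Q i j) t) (hdet : (P t).det ≠ 0) :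
    HasDerivAt (fun s => (P s).det) ((P t).det * ∑ i, ∑ j, Q i j * (P t)⁻¹ j i) t := by
  have h1 : HasDerivAt (fun s => (P s).det) (∑ σ : Equiv.Perm (Fin d), (Equiv.Perm.sign σ : ℝ) *
      ∑ i, (∏ j ∈ Finset.univ.erase i, P t (σ j) j) * Q (σ i) i) t := by
    simp only [Matrix.det_apply']
    refine HasDerivAt.fun_sum fun σ _ => ?_
    have := (HasDerivAt.fun_finsetProd (u := Finset.univ) (f := fun i s => P s (σ i) i)
      (f' := fun i => Q (σ i) i) (x := t) fun i _ => hP (σ i) i)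
    exact (this.const_mul _).congr_deriv (by simp)
  refine h1.congr_deriv ?_
  have h2 : ∀ i, ∑ σ : Equiv.Perm (Fin d), (Equiv.Perm.sign σ : ℝ) *
      ((∏ j ∈ Finset.univ.erase i, P t (σ j) j) * Q (σ i) i)
      = (P t).det * ∑ j, (P t)⁻¹ i j * Q j i := by
    intro i
    have h3 : ((P t).updateCol i (fun k => Q k i)).det = ∑ σ : Equiv.Perm (Fin d),
        (Equiv.Perm.sign σ : ℝ) * ((∏ j ∈ Finset.univ.erase i, P t (σ j) j) * Q (σ i) i) := by
      rw [Matrix.det_apply']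
      refine Finset.sum_congr rfl fun σ _ => ?_
      rw [← Finset.prod_erase_mul _ _ (Finset.mem_univ i)]
      congr 2
      · refine Finset.prod_congr rfl fun j hj => ?_
        rw [Matrix.updateCol_ne (Finset.ne_of_mem_erase hj)]
      · rw [Matrix.updateCol_self]
    rw [← h3, ← Matrix.cramer_apply, Matrix.cramer_eq_adjugate_mulVec]
    have h4 : (P t).adjugate = (P t).det • (P t)⁻¹ := by
      rw [Matrix.inv_def, smul_smul, Ring.inverse_eq_inv', mul_inv_cancel₀ hdet, one_smul]
    rw [h4, Matrix.smul_mulVec]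
    simp [Matrix.mulVec, dotProduct]
  simp only [Finset.mul_sum] at h2 ⊢
  rw [Finset.sum_comm]
  simp only [h2]
  rw [Finset.sum_comm]
  refine Finset.sum_congr rfl fun i _ => Finset.sum_congr rfl fun j _ => ?_
  ring

def matCLM {d : ℕ} (P : Matrix (Fin d) (Fin d) ℝ) : Ed d →L[ℝ] Ed d :=
  Matrix.toEuclideanCLM (n := Fin d) (𝕜 := ℝ) P

lemma matCLM_apply {d : ℕ} (P : Matrix (Fin d) (Fin d) ℝ) (v : Ed d) (i : Fin d) :
    matCLM P v i = ∑ j, P i j * v j := by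
  simp [matCLM, Matrix.mulVec, dotProduct]

lemma matCLM_mul {d : ℕ} (P Q : Matrix (Fin d) (Fin d) ℝ) :
    matCLM (P * Q) = matCLM P * matCLM Q := by simp [matCLM]

lemma inner_matCLM {d : ℕ} (P : Matrix (Fin d) (Fin d) ℝ) (v w : Ed d) :
    ⟪matCLM P v, w⟫ = ∑ i, ∑ j, P i j * v j * w i := by
  simp only [PiLp.inner_apply, matCLM_apply]
  refine Finset.sum_congr rfl fun i _ => ?_
  simp [Finset.mul_sum]
  refine Finset.sum_congr rfl fun j _ => ?_
  ring

lemma matCLM_symm {d : ℕ} {P : Matrix (Fin d) (Fin d) ℝ} (hP : P.IsSymm) (v w : Ed d) :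
    ⟪matCLM P v, w⟫ = ⟪v, matCLM P w⟫ := by
  rw [real_inner_comm _ v, inner_matCLM, inner_matCLM, Finset.sum_comm]
  refine Finset.sum_congr rfl fun i _ => Finset.sum_congr rfl fun j _ => ?_
  rw [hP.apply]; ring

lemma quad_eq {d : ℕ} (P : Matrix (Fin d) (Fin d) ℝ) (v : Ed d) :
    ∑ i, ∑ j, P i j * v i * v j = ⟪matCLM P v, v⟫ := by
  rw [inner_matCLM]
  refine Finset.sum_congr rfl fun i _ => Finset.sum_congr rfl fun j _ => ?_
  ring

lemma hasDerivAt_matCLM {d : ℕ} {P : ℝ → Matrix (Fin d) (Fin d) ℝ} {Q : Matrix (Fin d) (Fin d) ℝ}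
    {t : ℝ} (hP : ∀ i j, HasDerivAt (fun s => P s i j) (Q i j) t) :
    HasDerivAt (fun s => matCLM (P s)) (matCLM Q) t := by
  have h : ∀ A : Matrix (Fin d) (Fin d) ℝ,
      matCLM A = ∑ i, ∑ j, A i j • matCLM (Matrix.single i j 1) := by
    intro A
    have h1 : A = ∑ i, ∑ j, A i j • Matrix.single i j (1:ℝ) := by
      conv_lhs => rw [Matrix.matrix_eq_sum_single A]
      simp
    conv_lhs => rw [h1]
    simp only [matCLM, map_sum, map_smul]
  rw [h Q]
  simp only [h (P _)]
  exact HasDerivAt.fun_sum fun i _ => HasDerivAt.fun_sum fun j _ => 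
    HasDerivAt.smul_const (F := Ed d →L[ℝ] Ed d) (hP i j) _

lemma hasDerivAt_invquad {d : ℕ} {P : ℝ → Matrix (Fin d) (Fin d) ℝ}
    {Q : Matrix (Fin d) (Fin d) ℝ}
    {t : ℝ} (hP : ∀ i j, HasDerivAt (fun s => P s i j) (Q i j) t) (hdet : ∀ᶠ s in 𝓝 t, (P s).det ≠ 0)
    (hsym : (P t).IsSymm) (y : Ed d) :
    HasDerivAt (fun s => ⟪matCLM (P s)⁻¹ y, y⟫)
      (-(∑ i, ∑ j, Q i j * matCLM (P t)⁻¹ y i * matCLM (P t)⁻¹ y j)) t := by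
  have hunit : ∀ s, (P s).det ≠ 0 → matCLM (P s) * matCLM (P s)⁻¹ = 1 ∧
      matCLM (P s)⁻¹ * matCLM (P s) = 1 := by
    intro s hs
    rw [← matCLM_mul, ← matCLM_mul, Matrix.mul_nonsing_inv _ (isUnit_iff_ne_zero.2 hs),
      Matrix.nonsing_inv_mul _ (isUnit_iff_ne_zero.2 hs)]
    simp [matCLM]
  have hinv : ∀ s, (P s).det ≠ 0 → Ring.inverse (matCLM (P s)) = matCLM (P s)⁻¹ := by
    intro s hs
    exact Ring.inverse_unit (⟨_, _, (hunit s hs).1, (hunit s hs).2⟩ : (Ed d →L[ℝ] Ed d)ˣ)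
  have ht := hdet.self_of_nhds
  set U : (Ed d →L[ℝ] Ed d)ˣ := ⟨_, _, (hunit t ht).1, (hunit t ht).2⟩ with hU
  have h1 := (hasFDerivAt_ringInverse (𝕜 := ℝ) U).comp_hasDerivAt t (hasDerivAt_matCLM hP)
  have h2 : HasDerivAt (fun s => matCLM (P s)⁻¹)
      (-(matCLM (P t)⁻¹ * matCLM Q * matCLM (P t)⁻¹)) t := by
    refine (h1.congr_of_eventuallyEq ?_).congr_deriv ?_
    · filter_upwards [hdet] with s hs
      exact (hinv s hs).symm
    · simp [hU]
  have h3 := (h2.clm_apply (hasDerivAt_const t y)).inner ℝ (hasDerivAt_const t y)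
  refine h3.congr_deriv ?_
  rw [quad_eq]
  have hs : ((P t)⁻¹).IsSymm := by
    rw [Matrix.IsSymm, Matrix.transpose_nonsing_inv, hsym.eq]
  simp [inner_neg_left, matCLM_symm hs]

lemma barrier_arith {a n Y l r K1 K2 K3 C Θ Θx tr0 trx bp : ℝ} (ha : 0 < a) (ha1 : a ≤ 1)
    (hn : 0 ≤ n) (hl : 0 ≤ l) (hK1 : 0 ≤ K1) (hK2 : 0 ≤ K2) (hK3 : 0 ≤ K3)
    (hYr : Y ≤ r) (hYl : Y ≤ l * a * n) (hr : 2 * K1 * r ≤ 1 / 4)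
    (h1 : Θ - Θx ≤ K1 * Y * n ^ 2 / a ^ 2) (h2 : trx - tr0 ≤ K1 * Y / a ^ 2)
    (h3 : trx ≤ K2 / a ^ 2) (h4 : Θx ≤ K2 * n ^ 2 / a ^ 2) (h4' : 0 ≤ Θx)
    (h5 : bp ≤ K3 * n / a)
    (hC : 2 * (2 * (K1 * l + 12 * K2 + 5 * K3) + 3 * (K1 * l + 12 * K2 + 5 * K3) *
      (12 * (K1 * l + 12 * K2 + 5 * K3)) ^ 3) ≤ C) :
    -((n ^ 4 + C) / (2 * a)) + (1 / 4 + 2 * a * n ^ 2) * Θ - 1 / 2 * tr0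
      + 2 * (1 / 4 + 2 * a * n ^ 2) * trx + 8 * a * Θx - 4 * (1 / 4 + 2 * a * n ^ 2) ^ 2 * Θx
      + 2 * (1 / 4 + 2 * a * n ^ 2) * bp ≤ 0 := by
  set K := K1 * l + 12 * K2 + 5 * K3 with hK
  have hK0 : 0 ≤ K := by positivity
  have hF : (1 / 4 : ℝ) ≤ 1 / 4 + 2 * a * n ^ 2 := by
    have : 0 ≤ 2 * a * n ^ 2 := by positivity
    linarith
  set F := 1 / 4 + 2 * a * n ^ 2 with hFd
  have g1 : F * Θ - 4 * F ^ 2 * Θx ≤ F * (Θ - Θx) := by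
    have : 0 ≤ F * Θx * (4 * F - 1) := mul_nonneg (by positivity) (by linarith)
    linarith
  have g2 : F * (Θ - Θx) ≤ (K1 * l / 4 * n ^ 3 + n ^ 4 / 4) / a := by
    have e1 : F * (Θ - Θx) ≤ F * (K1 * Y * n ^ 2 / a ^ 2) := by gcongr
    have e2 : F * (K1 * Y * n ^ 2 / a ^ 2) = 1 / 4 * (K1 * Y * n ^ 2 / a ^ 2)
      + 2 * K1 * Y * n ^ 4 / a := by rw [hFd]; field_simp
    have e3 : K1 * Y * n ^ 2 / a ^ 2 ≤ K1 * (l * a * n) * n ^ 2 / a ^ 2 := by gcongr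
    have e4 : K1 * (l * a * n) * n ^ 2 / a ^ 2 = K1 * l * n ^ 3 / a := by field_simp
    have e5 : 2 * K1 * Y * n ^ 4 / a ≤ 1 / 4 * n ^ 4 / a := by
      have : 2 * K1 * Y ≤ 1 / 4 := le_trans (by gcongr) hr
      gcongr
    have e6 : (K1 * l / 4 * n ^ 3 + n ^ 4 / 4) / a
      = 1 / 4 * (K1 * l * n ^ 3 / a) + 1 / 4 * n ^ 4 / a := by ring
    rw [e6, ← e4]; linarith
  have g3 : 2 * F * trx - 1 / 2 * tr0 ≤ (K1 * l / 2 * n + 4 * K2 * n ^ 2) / a := by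
    have e1 : 2 * F * trx - 1 / 2 * tr0 = 1 / 2 * (trx - tr0) + 4 * a * n ^ 2 * trx := by
      rw [hFd]; ring
    have e2 : 4 * a * n ^ 2 * trx ≤ 4 * a * n ^ 2 * (K2 / a ^ 2) := by gcongr
    have e3 : 4 * a * n ^ 2 * (K2 / a ^ 2) = 4 * K2 * n ^ 2 / a := by field_simp
    have e4 : K1 * Y / a ^ 2 ≤ K1 * (l * a * n) / a ^ 2 := by gcongr
    have e5 : K1 * (l * a * n) / a ^ 2 = K1 * l * n / a := by field_simp
    have e6 : (K1 * l / 2 * n + 4 * K2 * n ^ 2) / a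
      = 1 / 2 * (K1 * l * n / a) + 4 * K2 * n ^ 2 / a := by ring
    rw [e6, e1]; linarith
  have g4 : 8 * a * Θx ≤ 8 * K2 * n ^ 2 / a := by
    have e1 : 8 * a * Θx ≤ 8 * a * (K2 * n ^ 2 / a ^ 2) := by gcongr
    have e2 : 8 * a * (K2 * n ^ 2 / a ^ 2) = 8 * K2 * n ^ 2 / a := by field_simp
    linarith
  have g5 : 2 * F * bp ≤ (K3 / 2 * n + 4 * K3 * n ^ 3) / a := by
    have e1 : 2 * F * bp ≤ 2 * F * (K3 * n / a) := by gcongr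
    have e2 : 2 * F * (K3 * n / a) = (K3 / 2 * n + 4 * K3 * n ^ 3 * a) / a := by
      rw [hFd]; ring
    have e3 : (K3 / 2 * n + 4 * K3 * n ^ 3 * a) / a ≤ (K3 / 2 * n + 4 * K3 * n ^ 3 * 1) / a := by
      gcongr
    rw [mul_one] at e3
    linarith
  have hfin : -(n ^ 4 + C) / 2 + n ^ 4 / 4 + K * (n + n ^ 2 + n ^ 3) ≤ 0 := by
    have hn3 : 0 ≤ n ^ 3 := by positivity
    have y1 : n ≤ 1 + n ^ 3 := by
      rcases le_total n 1 with h | h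
      · linarith
      · have : n ^ 1 ≤ n ^ 3 := pow_le_pow_right₀ h (by norm_num)
        linarith
    have y2 : n ^ 2 ≤ 1 + n ^ 3 := by
      rcases le_total n 1 with h | h
      · have : n ^ 2 ≤ 1 := pow_le_one₀ hn h
        linarith
      · have : n ^ 2 ≤ n ^ 3 := pow_le_pow_right₀ h (by norm_num)
        linarith
    have y3 : K * (n + n ^ 2 + n ^ 3) ≤ K * (2 + 3 * n ^ 3) :=
      mul_le_mul_of_nonneg_left (by linarith) hK0
    have y4 : 3 * K * n ^ 3 ≤ n ^ 4 / 4 + 3 * K * (12 * K) ^ 3 := by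
      rcases le_total (12 * K) n with h | h
      · have : 12 * K * n ^ 3 ≤ n * n ^ 3 := by gcongr
        have : 0 ≤ 3 * K * (12 * K) ^ 3 := by positivity
        have : n * n ^ 3 = n ^ 4 := by ring
        linarith
      · have : 3 * K * n ^ 3 ≤ 3 * K * (12 * K) ^ 3 := by gcongr
        have : 0 ≤ n ^ 4 := by positivity
        linarith
    linarith
  have hfin2 : (-(n ^ 4 + C) / 2 + n ^ 4 / 4 + K * (n + n ^ 2 + n ^ 3)) / a ≤ 0 :=
    div_nonpos_of_nonpos_of_nonneg hfin ha.le
  have hx : (K1 * l / 4 * n ^ 3 + n ^ 4 / 4) / a + (K1 * l / 2 * n + 4 * K2 * n ^ 2) / a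
      + 8 * K2 * n ^ 2 / a + (K3 / 2 * n + 4 * K3 * n ^ 3) / a
      ≤ (n ^ 4 / 4 + K * (n + n ^ 2 + n ^ 3)) / a := by
    rw [← add_div, ← add_div, ← add_div]
    refine div_le_div_of_nonneg_right ?_ ha.le
    rw [hK]
    have : 0 ≤ K1 * l := by positivity
    have z1 : 0 ≤ K1 * l * n := by positivity
    have z2 : 0 ≤ K1 * l * n ^ 2 := by positivity
    have z3 : 0 ≤ K1 * l * n ^ 3 := by positivity
    have z4 : 0 ≤ K2 * n := by positivity
    have z5 : 0 ≤ K2 * n ^ 3 := by positivity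
    have z6 : 0 ≤ K3 * n := by positivity
    have z7 : 0 ≤ K3 * n ^ 2 := by positivity
    have z8 : 0 ≤ K3 * n ^ 3 := by positivity
    linarith
  have hy : (-(n ^ 4 + C) / 2 + n ^ 4 / 4 + K * (n + n ^ 2 + n ^ 3)) / a
    = -((n ^ 4 + C) / (2 * a)) + (n ^ 4 / 4 + K * (n + n ^ 2 + n ^ 3)) / a := by
    field_simp; ring
  linarith

lemma abs_apply_le_norm {d : ℕ} (v : Ed d) (i : Fin d) : |v i| ≤ ‖v‖ := by
  simpa using PiLp.norm_apply_le v i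

lemma sum_sum_le {d : ℕ} {f : Fin d → Fin d → ℝ} {c : ℝ} (h : ∀ i j, f i j ≤ c) :
    ∑ i, ∑ j, f i j ≤ d ^ 2 * c := by
  calc ∑ i, ∑ j, f i j ≤ ∑ _i : Fin d, ∑ _j : Fin d, c :=
        Finset.sum_le_sum fun i _ => Finset.sum_le_sum fun j _ => h i j
    _ = d ^ 2 * c := by simp; ring

lemma quad_le {d : ℕ} {P : Matrix (Fin d) (Fin d) ℝ} {C : ℝ} (hC : ∀ i j, |P i j| ≤ C) (v : Ed d) :
    ∑ i, ∑ j, P i j * v i * v j ≤ d ^ 2 * (C * ‖v‖ ^ 2) := by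
  apply sum_sum_le
  intro i j
  have hC0 : 0 ≤ C := (abs_nonneg _).trans (hC i j)
  calc P i j * v i * v j ≤ |P i j * v i * v j| := le_abs_self _
    _ = |P i j| * |v i| * |v j| := by rw [abs_mul, abs_mul]
    _ ≤ C * ‖v‖ * ‖v‖ := by
      gcongr
      · exact hC i j
      · exact abs_apply_le_norm v i
      · exact abs_apply_le_norm v j
    _ = _ := by ring

section posdata
variable {d : ℕ} {P : Matrix (Fin d) (Fin d) ℝ} {c : ℝ}

lemma pos_det (hs : P.IsSymm) (hc : 0 < c)
    (h : ∀ ξ : Ed d, c * ‖ξ‖ ^ 2 ≤ ∑ i, ∑ j, P i j * ξ i * ξ j) : 0 < P.det := by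
  apply Matrix.PosDef.det_pos
  refine Matrix.PosDef.of_dotProduct_mulVec_pos ?_ ?_
  · ext i j; simpa using hs.apply i j
  · intro x hx
    have h1 := h (WithLp.toLp 2 x)
    have h2 : 0 < ‖(WithLp.toLp 2 x : Ed d)‖ := by
      rw [norm_pos_iff]; intro h0; exact hx (by simpa using h0)
    have h3 : star x ⬝ᵥ P.mulVec x = ∑ i, ∑ j, P i j * x i * x j := by
      simp only [dotProduct, Matrix.mulVec, Finset.mul_sum]
      refine Finset.sum_congr rfl fun i _ => Finset.sum_congr rfl fun j _ => ?_
      simp; ring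
    rw [h3]
    have : 0 < c * ‖(WithLp.toLp 2 x : Ed d)‖ ^ 2 := by positivity
    linarith

lemma matCLM_inv_cancel (hd : P.det ≠ 0) (y : Ed d) : matCLM P (matCLM P⁻¹ y) = y := by
  have : matCLM (P * P⁻¹) y = y := by
    rw [Matrix.mul_nonsing_inv _ (isUnit_iff_ne_zero.2 hd)]; simp [matCLM]
  simpa [matCLM_mul] using this

lemma inv_symm (hs : P.IsSymm) : (P⁻¹).IsSymm := by
  rw [Matrix.IsSymm, Matrix.transpose_nonsing_inv, hs.eq]

lemma inv_lower (hs : P.IsSymm) (hc : 0 < c)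
    (h : ∀ ξ : Ed d, c * ‖ξ‖ ^ 2 ≤ ∑ i, ∑ j, P i j * ξ i * ξ j) (y : Ed d) :
    c * ‖matCLM P⁻¹ y‖ ^ 2 ≤ ⟪matCLM P⁻¹ y, y⟫ := by
  have h1 := h (matCLM P⁻¹ y)
  rw [quad_eq, matCLM_inv_cancel (pos_det hs hc h).ne', real_inner_comm] at h1
  exact h1

lemma inv_norm (hs : P.IsSymm) (hc : 0 < c)
    (h : ∀ ξ : Ed d, c * ‖ξ‖ ^ 2 ≤ ∑ i, ∑ j, P i j * ξ i * ξ j) (y : Ed d) :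
    ‖matCLM P⁻¹ y‖ ≤ ‖y‖ / c := by
  have h1 := (inv_lower hs hc h y).trans (real_inner_le_norm _ _)
  rw [le_div_iff₀ hc]
  rcases (norm_nonneg (matCLM P⁻¹ y)).eq_or_lt with h0 | h0
  · rw [← h0]; simp
  · nlinarith

lemma inv_quad_le (hs : P.IsSymm) (hc : 0 < c)
    (h : ∀ ξ : Ed d, c * ‖ξ‖ ^ 2 ≤ ∑ i, ∑ j, P i j * ξ i * ξ j) (y : Ed d) :
    ⟪matCLM P⁻¹ y, y⟫ ≤ ‖y‖ ^ 2 / c := by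
  refine (real_inner_le_norm _ _).trans ?_
  have := inv_norm hs hc h y
  calc _ ≤ ‖y‖ / c * ‖y‖ := by gcongr
    _ = _ := by ring

lemma inv_quad_ge (hs : P.IsSymm) (hc : 0 < c)
    (h : ∀ ξ : Ed d, c * ‖ξ‖ ^ 2 ≤ ∑ i, ∑ j, P i j * ξ i * ξ j) {C K : ℝ}
    (hC : ∀ i j, |P i j| ≤ C) (hK : d ^ 2 * C ≤ K) (hK0 : 0 < K) (y : Ed d) :
    ‖y‖ ^ 2 ≤ K * ⟪matCLM P⁻¹ y, y⟫ := by
  set p := matCLM P⁻¹ y with hp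
  have hPp : matCLM P p = y := matCLM_inv_cancel (pos_det hs hc h).ne' y
  have h1 : 0 ≤ ⟪matCLM P (p - (1 / K) • y), p - (1 / K) • y⟫ := by
    rw [← quad_eq]; exact le_trans (by positivity) (h _)
  have h2 : ⟪matCLM P y, p⟫ = ‖y‖ ^ 2 := by
    rw [matCLM_symm hs, hPp, real_inner_self_eq_norm_sq]
  have h3 : ⟪matCLM P y, y⟫ ≤ K * ‖y‖ ^ 2 := by
    rw [← quad_eq]
    refine (quad_le hC y).trans ?_
    rw [← mul_assoc]; gcongr
  have h4 : ⟪matCLM P (p - (1 / K) • y), p - (1 / K) • y⟫ =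
      ⟪p, y⟫ - 2 * (1 / K) * ‖y‖ ^ 2 + (1 / K) ^ 2 * ⟪matCLM P y, y⟫ := by
    rw [map_sub, map_smul, hPp]
    simp only [inner_sub_left, inner_sub_right, real_inner_smul_left, real_inner_smul_right, h2,
      real_inner_self_eq_norm_sq]
    rw [real_inner_comm y p]; ring
  rw [h4] at h1
  have h5 : (1 / K) ^ 2 * ⟪matCLM P y, y⟫ ≤ (1 / K) ^ 2 * (K * ‖y‖ ^ 2) := by gcongr
  have h6 : (1 / K) ^ 2 * (K * ‖y‖ ^ 2) = 1 / K * ‖y‖ ^ 2 := by field_simp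
  have h7 : 1 / K * ‖y‖ ^ 2 ≤ ⟪p, y⟫ := by linarith
  have h8 := mul_le_mul_of_nonneg_left h7 hK0.le
  rwa [← mul_assoc, mul_one_div_cancel hK0.ne', one_mul] at h8

lemma inv_entry (hs : P.IsSymm) (hc : 0 < c)
    (h : ∀ ξ : Ed d, c * ‖ξ‖ ^ 2 ≤ ∑ i, ∑ j, P i j * ξ i * ξ j) (i j : Fin d) :
    |matCLM P⁻¹ (EuclideanSpace.single i 1) j| ≤ 1 / c := by
  refine (abs_apply_le_norm _ _).trans ((inv_norm hs hc h _).trans ?_)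
  simp

lemma matCLM_single (A : Matrix (Fin d) (Fin d) ℝ) (i j : Fin d) :
    matCLM A (EuclideanSpace.single i 1) j = A j i := by
  rw [matCLM_apply]; simp

lemma det_upper {C : ℝ} (hC : ∀ i j, |P i j| ≤ C) : P.det ≤ d.factorial * C ^ d := by
  have := Matrix.det_le (A := P) (abv := (AbsoluteValue.abs : AbsoluteValue ℝ ℝ)) (x := C) hC
  refine (le_abs_self _).trans ?_
  simpa using this

lemma det_lower (hs : P.IsSymm) (hc : 0 < c)
    (h : ∀ ξ : Ed d, c * ‖ξ‖ ^ 2 ≤ ∑ i, ∑ j, P i j * ξ i * ξ j) :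
    c ^ d ≤ d.factorial * P.det := by
  have h0 := pos_det hs hc h
  have h1 : (P⁻¹).det ≤ d.factorial * (1 / c) ^ d := by
    apply det_upper
    intro i j
    rw [← matCLM_single P⁻¹ j i]; exact inv_entry hs hc h _ _
  rw [Matrix.det_nonsing_inv, Ring.inverse_eq_inv'] at h1
  have h2 := mul_le_mul_of_nonneg_left h1 (mul_pos h0 (pow_pos hc d)).le
  have h3 : P.det * c ^ d * (P.det)⁻¹ = c ^ d := by field_simp
  have h4 : P.det * c ^ d * (d.factorial * (1 / c) ^ d) = d.factorial * P.det := by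
    rw [div_pow]; field_simp; simp
  rwa [h3, h4] at h2
end posdata

/-- Integrated frozen diffusion matrix. -/
def Pmat {d : ℕ} (H : Hypotheses d) (x0 : Ed d) (s ε t : ℝ) : Matrix (Fin d) (Fin d) ℝ :=
  fun i j => (if i = j then ε else 0) + ∫ r in s..t, H.q (max r 0) x0 i j

lemma max_mem (r : ℝ) : max r 0 ∈ Ici (0:ℝ) := mem_Ici.2 (le_max_right r 0)

section Pm
variable {d : ℕ} (H : Hypotheses d) (x0 : Ed d)

lemma q0_cont (i j : Fin d) : Continuous fun r : ℝ => H.q (max r 0) x0 i j := by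
  have h := H.q_cont (‖x0‖ + 1) (by positivity) i j
  have h2 : Continuous fun r : ℝ => ((max r 0, x0) : ℝ × Ed d) := by fun_prop
  have := h.comp_continuous h2 (fun r => ⟨max_mem r, by simp⟩)
  exact this

lemma Pmat_deriv (s ε t : ℝ) (i j : Fin d) :
    HasDerivAt (fun t => Pmat H x0 s ε t i j) (H.q (max t 0) x0 i j) t := by
  have h := q0_cont H x0 i j
  exact (intervalIntegral.integral_hasDerivAt_right (h.intervalIntegrable _ _)
    (h.stronglyMeasurableAtFilter _ _) h.continuousAt).const_add _

lemma Pmat_symm (s ε t : ℝ) : (Pmat H x0 s ε t).IsSymm := by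
  ext i j
  have h1 : ∀ r, H.q (max r 0) x0 j i = H.q (max r 0) x0 i j :=
    fun r => (H.q_symm (max r 0) (max_mem r) x0).apply i j
  simp only [Matrix.transpose_apply, Pmat, h1, eq_comm]

lemma Pmat_lower {s ε t η : ℝ} (hst : s ≤ t) (hε : 0 ≤ ε) (hη : η ≤ H.η₀)
    (hη1 : η ≤ 1) (ξ : Ed d) :
    η * (ε + (t - s)) * ‖ξ‖ ^ 2 ≤ ∑ i, ∑ j, Pmat H x0 s ε t i j * ξ i * ξ j := by
  have h0 : ∑ i, ∑ j, Pmat H x0 s ε t i j * ξ i * ξ j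
      = ε * ‖ξ‖ ^ 2 + ∫ r in s..t, ∑ i, ∑ j, H.q (max r 0) x0 i j * ξ i * ξ j := by
    rw [intervalIntegral.integral_finsetSum]
    · have : ∀ i, ∫ r in s..t, ∑ j, H.q (max r 0) x0 i j * ξ i * ξ j
        = ∑ j, (∫ r in s..t, H.q (max r 0) x0 i j) * ξ i * ξ j := by
        intro i
        rw [intervalIntegral.integral_finsetSum]
        · refine Finset.sum_congr rfl fun j _ => ?_
          rw [intervalIntegral.integral_mul_const, intervalIntegral.integral_mul_const]
        · intro j _
          have := q0_cont H x0 i j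
          exact Continuous.intervalIntegrable (by fun_prop) _ _
      simp only [this]
      rw [EuclideanSpace.real_norm_sq_eq, Finset.mul_sum, ← Finset.sum_add_distrib]
      refine Finset.sum_congr rfl fun i _ => ?_
      simp only [Pmat, add_mul, Finset.sum_add_distrib]
      congr 1
      simp; ring
    · intro i _
      have := fun j => q0_cont H x0 i j
      exact Continuous.intervalIntegrable (by fun_prop) _ _
  have h1 : (t - s) * (η * ‖ξ‖ ^ 2) ≤ ∫ r in s..t, ∑ i, ∑ j, H.q (max r 0) x0 i j * ξ i * ξ j := by
    have : (t - s) * (η * ‖ξ‖ ^ 2) = ∫ _r in s..t, η * ‖ξ‖ ^ 2 := by simp; ring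
    rw [this]
    apply intervalIntegral.integral_mono_on hst (by simp)
    · have := fun i j => q0_cont H x0 i j
      exact Continuous.intervalIntegrable (by fun_prop) _ _
    · intro r _
      have h2 := H.ellipticity (max r 0) (max_mem r) x0 ξ
      have h3 := H.η_lb (max r 0) (max_mem r) x0
      refine le_trans ?_ h2
      gcongr; linarith
  rw [h0]
  have : η * (ε * ‖ξ‖ ^ 2) ≤ 1 * (ε * ‖ξ‖ ^ 2) := by gcongr
  linarith

lemma Pmat_upper {s ε t M : ℝ} (hst : s ≤ t) (hε : 0 ≤ ε) (hM1 : 1 ≤ M)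
    (hM : ∀ t, 0 ≤ t → ∀ i j, |H.q t x0 i j| ≤ M) (i j : Fin d) :
    |Pmat H x0 s ε t i j| ≤ M * (ε + (t - s)) := by
  have h1 : |∫ r in s..t, H.q (max r 0) x0 i j| ≤ M * |t - s| := by
    rw [← Real.norm_eq_abs]
    apply intervalIntegral.norm_integral_le_of_norm_le_const
    intro r _
    exact hM _ (le_max_right _ _) i j
  rw [abs_of_nonneg (by linarith : 0 ≤ t - s)] at h1
  have h2 : |(if i = j then ε else 0)| ≤ M * ε := by
    split_ifs
    · rw [abs_of_nonneg hε]; nlinarith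
    · simp; positivity
  calc _ ≤ _ := abs_add_le _ _
    _ ≤ M * ε + M * (t - s) := add_le_add h2 h1
    _ = _ := by ring

lemma Pmat_init (s ε : ℝ) : Pmat H x0 s ε s = ε • (1 : Matrix (Fin d) (Fin d) ℝ) := by
  ext i j
  simp [Pmat, Matrix.one_apply]

def barN (s ε t : ℝ) (x : Ed d) : ℝ := ⟪matCLM (Pmat H x0 s ε t)⁻¹ (x - x0), x - x0⟫

def bar (s ε C m0 t : ℝ) (x : Ed d) : ℝ :=
  Real.exp (-(1 / 2 * Real.log (Pmat H x0 s ε t).det + 1 / 4 * barN H x0 s ε t x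
    + Real.sqrt (ε + (t - s)) * barN H x0 s ε t x ^ 2 + C * Real.sqrt (ε + (t - s)))) - m0

lemma Pmat_det_pos {s ε t : ℝ} (hst : s ≤ t) (hε : 0 < ε) : 0 < (Pmat H x0 s ε t).det := by
  have hη := H.hη₀
  have hm : 0 < min H.η₀ 1 := by positivity
  exact pos_det (Pmat_symm H x0 s ε t) (c := min H.η₀ 1 * (ε + (t - s)))
    (mul_pos hm (by linarith))
    (Pmat_lower H x0 hst hε.le (min_le_left _ _) (min_le_right _ _))

lemma Pmat_cont (s ε : ℝ) : Continuous fun t => Pmat H x0 s ε t := by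
  refine continuous_matrix fun i j => ?_
  exact continuous_iff_continuousAt.2 fun t => (Pmat_deriv H x0 s ε t i j).continuousAt

lemma bar_cont {s ε C m0 : ℝ} (hε : 0 < ε) :
    ContinuousOn (fun z : ℝ × Ed d => bar H x0 s ε C m0 z.1 z.2) (Ici s ×ˢ univ) := by
  have hP : Continuous fun z : ℝ × Ed d => Pmat H x0 s ε z.1 :=
    (Pmat_cont H x0 s ε).comp continuous_fst
  have hdet : Continuous fun z : ℝ × Ed d => (Pmat H x0 s ε z.1).det := hP.matrix_det
  have hadj : Continuous fun z : ℝ × Ed d => (Pmat H x0 s ε z.1).adjugate := hP.matrix_adjugate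
  have hne : ∀ z ∈ Ici s ×ˢ (univ : Set (Ed d)), (Pmat H x0 s ε z.1).det ≠ 0 :=
    fun z hz => (Pmat_det_pos H x0 hz.1 hε).ne'
  have hN : ContinuousOn (fun z : ℝ × Ed d => barN H x0 s ε z.1 z.2) (Ici s ×ˢ univ) := by
    have : (fun z : ℝ × Ed d => barN H x0 s ε z.1 z.2) = fun z : ℝ × Ed d =>
        ((Pmat H x0 s ε z.1).det)⁻¹ *
          ∑ i, ∑ j, (Pmat H x0 s ε z.1).adjugate i j * (z.2 - x0) j * (z.2 - x0) i := by
      funext z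
      simp only [barN, inner_matCLM, Matrix.inv_def, Ring.inverse_eq_inv', Finset.mul_sum]
      refine Finset.sum_congr rfl fun i _ => Finset.sum_congr rfl fun j _ => ?_
      simp; ring
    rw [this]
    refine (hdet.continuousOn.inv₀ hne).mul (Continuous.continuousOn ?_)
    have := fun i j => hadj.matrix_elem i j
    fun_prop
  have hlog := hdet.continuousOn.log hne
  unfold bar
  fun_prop

lemma bar_smooth (s ε C m0 t : ℝ) : ContDiff ℝ 2 (bar H x0 s ε C m0 t) := by
  unfold bar barN
  have h0 : ContDiff ℝ 2 fun x : Ed d => x - x0 := by fun_prop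
  have h1 : ContDiff ℝ 2 fun x : Ed d => ⟪matCLM (Pmat H x0 s ε t)⁻¹ (x - x0), x - x0⟫ :=
    ((ContinuousLinearMap.contDiff _).comp h0).inner ℝ h0
  fun_prop
end Pm

set_option maxHeartbeats 1000000 in
lemma bar_sub {d : ℕ} (H : Hypotheses d) (x0 : Ed d) {s ε C m0 η M L B r t : ℝ} {x : Ed d}
    (hs : 0 ≤ s) (hst : s < t) (hε : 0 < ε) (hτ : ε + (t - s) ≤ 1)
    (hη : 0 < η) (hη0 : η ≤ H.η₀) (hη1 : η ≤ 1) (hM1 : 1 ≤ M) (hL : 0 ≤ L) (hB : 0 ≤ B)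
    (hM : ∀ t, 0 ≤ t → ∀ y, ‖y - x0‖ ≤ r → ∀ i j, |H.q t y i j| ≤ M)
    (hLq : ∀ t, 0 ≤ t → ∀ y, ‖y - x0‖ ≤ r → ∀ i j, |H.q t y i j - H.q t x0 i j| ≤ L * ‖y - x0‖)
    (hBb : ∀ t, 0 ≤ t → ∀ y, ‖y - x0‖ ≤ r → ‖H.b t y‖ ≤ B)
    (hr : 2 * (d ^ 2 * L / η) * r ≤ 1 / 4) (hxr : ‖x - x0‖ ≤ r)
    (hC : 2 * (2 * ((d ^ 2 * L / η) * Real.sqrt (d ^ 2 * M + 1) + 12 * (d ^ 2 * M / η)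
        + 5 * (B / Real.sqrt η)) + 3 * ((d ^ 2 * L / η) * Real.sqrt (d ^ 2 * M + 1)
        + 12 * (d ^ 2 * M / η) + 5 * (B / Real.sqrt η)) *
      (12 * ((d ^ 2 * L / η) * Real.sqrt (d ^ 2 * M + 1) + 12 * (d ^ 2 * M / η)
        + 5 * (B / Real.sqrt η))) ^ 3) ≤ C) :
    ∃ w', HasDerivAt (fun τ => bar H x0 s ε C m0 τ x) w' t ∧
      w' ≤ applyA H.q H.b t (bar H x0 s ε C m0 t) x := by
  have ht0 : 0 ≤ t := hs.trans hst.le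
  have hr0 : 0 ≤ r := (norm_nonneg _).trans hxr
  have hmax : max t 0 = t := max_eq_left ht0
  set τ := ε + (t - s) with hτd
  have hτ0 : 0 < τ := by linarith
  set P := Pmat H x0 s ε t with hPd
  set y := x - x0 with hy
  set T := matCLM P⁻¹ with hT
  set p := T y with hp
  set N := ⟪T y, y⟫ with hNd
  have hsymm := Pmat_symm H x0 s ε t
  have hc : 0 < η * τ := by positivity
  have hlow := Pmat_lower H x0 hst.le hε.le hη0 hη1
  have hup := Pmat_upper H x0 hst.le hε.le hM1 (fun t ht => hM t ht x0 (by simpa using hr0))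
  have hdet : 0 < P.det := Pmat_det_pos H x0 hst.le hε
  have hTsymm : ∀ v w, ⟪T v, w⟫ = ⟪v, T w⟫ := matCLM_symm (inv_symm hsymm)
  -- derivative in time
  have hPder : ∀ i j, HasDerivAt (fun t => Pmat H x0 s ε t i j) (H.q t x0 i j) t := by
    intro i j
    have := Pmat_deriv H x0 s ε t i j
    rwa [hmax] at this
  have hdetd := hasDerivAt_det hPder hdet.ne'
  have hNder : HasDerivAt (fun t => barN H x0 s ε t x)
      (-(∑ i, ∑ j, H.q t x0 i j * p i * p j)) t := by
    refine hasDerivAt_invquad hPder ?_ hsymm y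
    exact ((Pmat_cont H x0 s ε).matrix_det.continuousAt).eventually_ne hdet.ne'
  have hsqrt : HasDerivAt (fun t : ℝ => Real.sqrt (ε + (t - s))) (1 / (2 * Real.sqrt τ)) t := by
    have := (((hasDerivAt_id t).sub_const s).const_add ε).sqrt (by simpa using hτ0.ne')
    simpa using this
  set a := Real.sqrt τ with ha
  have ha0 : 0 < a := Real.sqrt_pos.2 hτ0
  have ha2 : a ^ 2 = τ := Real.sq_sqrt hτ0.le
  have ha1 : a ≤ 1 := by rw [ha, Real.sqrt_le_one]; exact hτ
  have hwd := ((((((hdetd.log hdet.ne').const_mul (1 / 2)).add (hNder.const_mul (1 / 4))).add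
    (hsqrt.mul (hNder.pow 2))).add (hsqrt.const_mul C)).neg.exp).sub_const m0
  refine ⟨_, hwd, ?_⟩
  have hquad := quad_jets T hTsymm x0
    (fun σ => Real.exp (-(1 / 2 * Real.log P.det + 1 / 4 * σ + a * σ ^ 2 + C * a)) - m0)
    (fun σ => -(1 / 4 + 2 * a * σ) *
      Real.exp (-(1 / 2 * Real.log P.det + 1 / 4 * σ + a * σ ^ 2 + C * a)))
    (fun σ => ((1 / 4 + 2 * a * σ) ^ 2 - 2 * a) *
      Real.exp (-(1 / 2 * Real.log P.det + 1 / 4 * σ + a * σ ^ 2 + C * a)))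
    (fun σ => by
      have := ((((((hasDerivAt_id σ).const_mul (1 / 4)).const_add (1 / 2 * Real.log P.det)).add
        (((hasDerivAt_id σ).pow 2).const_mul a)).add_const (C * a)).neg.exp).sub_const m0
      refine this.congr_deriv ?_
      simp; ring)
    (fun σ => by
      have h1 := ((((((hasDerivAt_id σ).const_mul (1 / 4)).const_add (1 / 2 * Real.log P.det)).add
        (((hasDerivAt_id σ).pow 2).const_mul a)).add_const (C * a)).neg.exp)
      have h2 := (((hasDerivAt_id σ).const_mul (2 * a)).const_add (1 / 4)).neg
      refine (h2.mul h1).congr_deriv ?_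
      simp; ring) H.q H.b t x
  have hquad' : applyA H.q H.b t (bar H x0 s ε C m0 t) x = _ := hquad
  rw [hquad']
  simp only [← hy, ← hp]
  have hbN : barN H x0 s ε t x = N := rfl
  have hN0 : 0 ≤ N := le_trans (by positivity) (inv_lower hsymm hc hlow y)
  set n := Real.sqrt N with hn
  have hn0 : 0 ≤ n := Real.sqrt_nonneg _
  have hn2 : n ^ 2 = N := Real.sq_sqrt hN0
  have hp2 : ‖p‖ ^ 2 ≤ n ^ 2 / (η * a ^ 2) := by
    rw [le_div_iff₀ (by positivity), hn2, ha2, mul_comm]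
    exact inv_lower hsymm hc hlow y
  have hp1 : ‖p‖ ≤ n / (Real.sqrt η * a) := by
    refine abs_le_of_sq_le_sq' ?_ (by positivity) |>.2
    rw [div_pow, mul_pow, Real.sq_sqrt hη.le]; exact hp2
  have hY : ‖y‖ ≤ Real.sqrt (d ^ 2 * M + 1) * a * n := by
    refine abs_le_of_sq_le_sq' ?_ (by positivity) |>.2
    rw [mul_pow, mul_pow, Real.sq_sqrt (by positivity), hn2, ha2]
    refine inv_quad_ge hsymm hc hlow hup ?_ (by positivity) y
    nlinarith
  set Θ := ∑ i, ∑ j, H.q t x0 i j * p i * p j with hΘ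
  set Θx := ∑ i, ∑ j, H.q t x i j * p i * p j with hΘx
  set tr0 := ∑ i, ∑ j, H.q t x0 i j * P⁻¹ j i with htr0
  set trx := ∑ i, ∑ j, H.q t x i j * T (EuclideanSpace.single i 1) j with htrx
  have hent : ∀ i j, |T (EuclideanSpace.single i 1) j| ≤ 1 / (η * a ^ 2) := by
    intro i j; rw [ha2]; exact inv_entry hsymm hc hlow i j
  have key := barrier_arith (a := a) (n := n) (Y := ‖y‖) (l := Real.sqrt (d ^ 2 * M + 1)) (r := r)
    (K1 := d ^ 2 * L / η) (K2 := d ^ 2 * M / η) (K3 := B / Real.sqrt η) (C := C)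
    (Θ := Θ) (Θx := Θx) (tr0 := tr0) (trx := trx) (bp := ⟪p, H.b t x⟫) ha0 ha1 hn0
    (Real.sqrt_nonneg _) (by positivity) (by positivity) (by positivity) hxr hY hr
    ?_ ?_ ?_ ?_ (H.psd ht0 x p) ?_ hC
  · change Real.exp (-(1 / 2 * Real.log P.det + 1 / 4 * N + a * N ^ 2 + C * a)) *
        -(1 / 2 * (P.det * tr0 / P.det) + 1 / 4 * -Θ +
            (1 / (2 * a) * N ^ 2 + a * (((2:ℕ):ℝ) * N ^ (2 - 1) * -Θ)) +
          C * (1 / (2 * a))) ≤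
      -(1 / 4 + 2 * a * N) * Real.exp (-(1 / 2 * Real.log P.det + 1 / 4 * N + a * N ^ 2 + C * a)) *
        (2 * trx + 2 * ⟪p, H.b t x⟫) +
      ((1 / 4 + 2 * a * N) ^ 2 - 2 * a) *
          Real.exp (-(1 / 2 * Real.log P.det + 1 / 4 * N + a * N ^ 2 + C * a)) * (4 * Θx)
    have hE0 := Real.exp_pos (-(1 / 2 * Real.log P.det + 1 / 4 * N + a * N ^ 2 + C * a))
    generalize Real.exp (-(1 / 2 * Real.log P.det + 1 / 4 * N + a * N ^ 2 + C * a)) = E at hE0 ⊢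
    rw [mul_div_cancel_left₀ _ hdet.ne', ← hn2]
    have h1 := mul_nonpos_of_nonneg_of_nonpos hE0.le key
    have h2 : (n ^ 4 + C) / (2 * a) = 1 / (2 * a) * (n ^ 2) ^ 2 + C * (1 / (2 * a)) := by ring
    rw [h2] at h1
    norm_num only
    linarith
  · have h1 : Θ - Θx = ∑ i, ∑ j, (H.q t x0 i j - H.q t x i j) * p i * p j := by
      rw [hΘ, hΘx, ← Finset.sum_sub_distrib]
      refine Finset.sum_congr rfl fun i _ => ?_
      rw [← Finset.sum_sub_distrib]
      refine Finset.sum_congr rfl fun j _ => by ring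
    rw [h1]
    refine (quad_le (P := fun i j => H.q t x0 i j - H.q t x i j) (C := L * ‖y‖) ?_ p).trans ?_
    · intro i j; rw [abs_sub_comm]; exact hLq t ht0 x hxr i j
    · calc (d:ℝ) ^ 2 * (L * ‖y‖ * ‖p‖ ^ 2) ≤ d ^ 2 * (L * ‖y‖ * (n ^ 2 / (η * a ^ 2))) := by gcongr
        _ = _ := by field_simp
  · have h1 : trx - tr0 = ∑ i, ∑ j, (H.q t x i j - H.q t x0 i j)
        * T (EuclideanSpace.single i 1) j := by
      rw [htrx, htr0, ← Finset.sum_sub_distrib]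
      refine Finset.sum_congr rfl fun i _ => ?_
      rw [← Finset.sum_sub_distrib]
      refine Finset.sum_congr rfl fun j _ => ?_
      rw [hT, matCLM_single]; ring
    rw [h1]
    refine (sum_sum_le (c := L * ‖y‖ * (1 / (η * a ^ 2))) ?_).trans (le_of_eq ?_)
    · intro i j
      refine (le_abs_self _).trans ?_
      rw [abs_mul]
      have := hLq t ht0 x hxr i j
      have := hent i j
      gcongr
    · field_simp
  · refine (sum_sum_le (c := M * (1 / (η * a ^ 2))) ?_).trans (le_of_eq ?_)
    · intro i j
      refine (le_abs_self _).trans ?_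
      rw [abs_mul]
      have := hM t ht0 x hxr i j
      have := hent i j
      gcongr
    · field_simp
  · refine (quad_le (hM t ht0 x hxr) p).trans ?_
    calc (d:ℝ) ^ 2 * (M * ‖p‖ ^ 2) ≤ d ^ 2 * (M * (n ^ 2 / (η * a ^ 2))) := by gcongr
        _ = _ := by field_simp
  · refine (real_inner_le_norm _ _).trans ?_
    calc ‖p‖ * ‖H.b t x‖ ≤ n / (Real.sqrt η * a) * B := by
          have := hBb t ht0 x hxr
          gcongr
      _ = _ := by field_simp

lemma bdry_arith {D M η T τ C r Λ lf : ℝ} (hD : 0 ≤ D) (hη : 0 < η) (hηM : η ≤ M)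
    (hT : 0 < T) (hτ : 0 < τ) (hτT : τ ≤ 2 * T) (hC : 0 ≤ C) (hΛ : 0 < Λ) (hlf : 0 ≤ lf)
    (hTr : T * (8 * Λ * (1 / 2 * D + lf + 1 / 2 * D * Real.log (M / η) + C + 3)) ≤ r ^ 2) :
    1 / 2 * D * (Real.log (2 * M * T) - Real.log (η * τ)) + lf + C + 3 ≤ r ^ 2 / (4 * Λ * τ) := by
  set K0 := 1 / 2 * D + lf + 1 / 2 * D * Real.log (M / η) + C + 3 with hK0
  have hM : 0 < M := lt_of_lt_of_le hη hηM
  have hv1 : 1 ≤ 2 * T / τ := by rwa [le_div_iff₀ hτ, one_mul]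
  have hl0 : 0 ≤ Real.log (M / η) := Real.log_nonneg (by rwa [le_div_iff₀ hη, one_mul])
  have hl : Real.log (2 * M * T) - Real.log (η * τ) = Real.log (M / η) + Real.log (2 * T / τ) := by
    rw [← Real.log_div (by positivity) (by positivity), ← Real.log_mul (by positivity) (by positivity)]
    congr 1; field_simp
  have hlv : Real.log (2 * T / τ) ≤ 2 * T / τ := Real.log_le_self (by positivity)
  rw [hl]
  have h1 : 1 / 2 * D * (Real.log (M / η) + Real.log (2 * T / τ)) + lf + C + 3
      ≤ K0 * (2 * T / τ) := by
    have e1 : 1 / 2 * D * Real.log (2 * T / τ) ≤ 1 / 2 * D * (2 * T / τ) := by gcongr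
    have e2 : (1 / 2 * D * Real.log (M / η) + lf + C + 3) * 1
        ≤ (1 / 2 * D * Real.log (M / η) + lf + C + 3) * (2 * T / τ) := by gcongr
    rw [hK0]; linarith
  refine h1.trans ?_
  rw [le_div_iff₀ (by positivity)]
  calc K0 * (2 * T / τ) * (4 * Λ * τ) = T * (8 * Λ * K0) := by field_simp; ring
    _ ≤ r ^ 2 := hTr

/-- unnormalised heat kernel -/
def gf {d : ℕ} (x0 : Ed d) (ε : ℝ) (x : Ed d) : ℝ :=
  Real.exp (-(1 / 2 * (d * Real.log ε) + 1 / 4 * (‖x - x0‖ ^ 2 / ε)))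

lemma gf_Cb {d : ℕ} (x0 : Ed d) {ε : ℝ} (hε : 0 < ε) : IsCb (gf x0 ε) := by
  refine ⟨by unfold gf; fun_prop, Real.exp (-(1 / 2 * (d * Real.log ε))), fun x => ?_⟩
  rw [gf, abs_of_pos (Real.exp_pos _), Real.exp_le_exp]
  have : 0 ≤ ‖x - x0‖ ^ 2 / ε := by positivity
  linarith

lemma barN_init {d : ℕ} (H : Hypotheses d) (x0 : Ed d) {s ε : ℝ} (hε : 0 < ε) (x : Ed d) :
    barN H x0 s ε s x = ‖x - x0‖ ^ 2 / ε := by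
  have h := matCLM_inv_cancel (P := Pmat H x0 s ε s) (Pmat_det_pos H x0 le_rfl hε).ne' (x - x0)
  have h2 : ∀ v, matCLM (Pmat H x0 s ε s) v = ε • v := by
    intro v; rw [Pmat_init]; simp [matCLM]
  rw [h2] at h
  have h3 : matCLM (Pmat H x0 s ε s)⁻¹ (x - x0) = (1 / ε) • (x - x0) := by
    conv_rhs => rw [← h]
    rw [smul_smul, one_div_mul_cancel hε.ne', one_smul]
  rw [barN, h3, real_inner_smul_left, real_inner_self_eq_norm_sq]
  ring

lemma bar_init {d : ℕ} (H : Hypotheses d) (x0 : Ed d) {s ε C m0 : ℝ} (hε : 0 < ε) (hC : 0 ≤ C)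
    (hm0 : 0 ≤ m0) (x : Ed d) : bar H x0 s ε C m0 s x ≤ gf x0 ε x := by
  have h1 : (Pmat H x0 s ε s).det = ε ^ d := by rw [Pmat_init]; simp
  have : bar H x0 s ε C m0 s x ≤ gf x0 ε x - m0 := by
    rw [bar, gf, barN_init H x0 hε, h1, Real.log_pow]
    refine sub_le_sub_right (Real.exp_le_exp.2 ?_) _
    have : 0 ≤ √(ε + (s - s)) * (‖x - x0‖ ^ 2 / ε) ^ 2 + C * √(ε + (s - s)) := by positivity
    linarith
  linarith

lemma bar_bdry {d : ℕ} (H : Hypotheses d) (x0 : Ed d) {s ε C T η M r t : ℝ} {x : Ed d}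
    (hst : s ≤ t) (htT : t ≤ s + T) (hε : 0 < ε) (hεT : ε ≤ T)
    (hη : 0 < η) (hη0 : η ≤ H.η₀) (hη1 : η ≤ 1) (hM1 : 1 ≤ M) (hC : 0 ≤ C)
    (hM : ∀ t, 0 ≤ t → ∀ i j, |H.q t x0 i j| ≤ M) (hx : ‖x - x0‖ = r)
    (hTr : T * (8 * (d ^ 2 * M + 1) * (1 / 2 * d + Real.log d.factorial
      + 1 / 2 * d * Real.log (M / η) + C + 3)) ≤ r ^ 2) :
    bar H x0 s ε C (Real.exp (-(1 / 2 * (Real.log d.factorial + d * Real.log (2 * M * T))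
      + 2 + C)) / 2) t x ≤ 0 := by
  have hτ : 0 < ε + (t - s) := by linarith
  have hT : 0 < T := by linarith
  have hM0 : 0 < M := by linarith
  have hfac : (1:ℝ) ≤ d.factorial := by exact_mod_cast Nat.one_le_iff_ne_zero.2 d.factorial_ne_zero
  have hlf := Real.log_nonneg hfac
  have key := bdry_arith (D := d) (Nat.cast_nonneg d) hη (hη1.trans hM1) hT hτ (by linarith) hC
    (by positivity) hlf hTr
  have hsymm := Pmat_symm H x0 s ε t
  have hc : 0 < η * (ε + (t - s)) := by positivity
  have hlow := Pmat_lower H x0 hst hε.le hη0 hη1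
  have hup := Pmat_upper H x0 hst hε.le hM1 hM
  have hdet := Pmat_det_pos H x0 hst hε
  have h1 := det_lower hsymm hc hlow
  have h2 : d * Real.log (η * (ε + (t - s))) ≤ Real.log d.factorial
      + Real.log (Pmat H x0 s ε t).det := by
    rw [← Real.log_pow, ← Real.log_mul (by positivity) hdet.ne']
    exact Real.log_le_log (by positivity) h1
  have h3 := inv_quad_ge hsymm hc hlow hup (K := (d ^ 2 * M + 1) * (ε + (t - s))) (by nlinarith)
    (by positivity) (x - x0)
  rw [hx] at h3
  have h4 : r ^ 2 / (4 * (d ^ 2 * M + 1) * (ε + (t - s))) ≤ 1 / 4 * barN H x0 s ε t x := by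
    rw [div_le_iff₀ (by positivity)]
    change r ^ 2 ≤ _ * barN H x0 s ε t x at h3
    linarith
  have h5 : 0 ≤ √(ε + (t - s)) * barN H x0 s ε t x ^ 2 + C * √(ε + (t - s)) := by positivity
  have hlog2 : Real.log 2 ≤ 1 := by linarith [Real.log_two_lt_d9]
  have h6 : Real.exp (-(1 / 2 * (Real.log d.factorial + d * Real.log (2 * M * T)) + 2 + C)) / 2
      = Real.exp (-(1 / 2 * (Real.log d.factorial + d * Real.log (2 * M * T)) + 2 + C)
        - Real.log 2) := by
    rw [Real.exp_sub, Real.exp_log (by norm_num)]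
  rw [bar, h6, sub_nonpos, Real.exp_le_exp]
  linarith

lemma bar_center {d : ℕ} (H : Hypotheses d) (x0 : Ed d) {s ε C T η M : ℝ} {x : Ed d}
    (hε : 0 < ε) (hεT : ε ≤ T) (hT1 : T ≤ 1 / 2)
    (hη : 0 < η) (hη0 : η ≤ H.η₀) (hη1 : η ≤ 1) (hM1 : 1 ≤ M) (hC : 0 ≤ C)
    (hM : ∀ t, 0 ≤ t → ∀ i j, |H.q t x0 i j| ≤ M) (hx : ‖x - x0‖ ≤ √(η * T)) :
    Real.exp (-(1 / 2 * (Real.log d.factorial + d * Real.log (2 * M * T)) + 2 + C)) / 2 ≤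
    bar H x0 s ε C (Real.exp (-(1 / 2 * (Real.log d.factorial + d * Real.log (2 * M * T))
      + 2 + C)) / 2) (s + T) x := by
  have hT : 0 < T := by linarith
  have hst : s ≤ s + T := by linarith
  have hsT : s + T - s = T := by ring
  have hsymm := Pmat_symm H x0 s ε (s + T)
  have hM0 : 0 < M := by linarith
  have hlow := Pmat_lower H x0 hst hε.le hη0 hη1
  have hup := Pmat_upper H x0 hst hε.le hM1 hM
  have hdet := Pmat_det_pos H x0 hst hε
  rw [hsT] at hlow hup
  have hc : 0 < η * (ε + T) := by positivity
  have h1 : (Pmat H x0 s ε (s + T)).det ≤ d.factorial * (2 * M * T) ^ d := by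
    apply det_upper
    intro i j
    refine (hup i j).trans ?_
    nlinarith
  have h2 : Real.log (Pmat H x0 s ε (s + T)).det ≤ Real.log d.factorial
      + d * Real.log (2 * M * T) := by
    rw [← Real.log_pow, ← Real.log_mul (by positivity) (by positivity)]
    exact Real.log_le_log hdet h1
  have hN1 : barN H x0 s ε (s + T) x ≤ 1 := by
    refine (inv_quad_le hsymm hc hlow (x - x0)).trans ?_
    rw [div_le_one hc]
    calc ‖x - x0‖ ^ 2 ≤ √(η * T) ^ 2 := by gcongr
      _ = η * T := Real.sq_sqrt (by positivity)
      _ ≤ _ := by gcongr; linarith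
  have hN0 : 0 ≤ barN H x0 s ε (s + T) x := le_trans (by positivity) (inv_lower hsymm hc hlow _)
  have hs1 : √(ε + (s + T - s)) ≤ 1 := by rw [hsT, Real.sqrt_le_one]; linarith
  have h3 : √(ε + (s + T - s)) * barN H x0 s ε (s + T) x ^ 2 ≤ 1 * 1 ^ 2 := by gcongr
  have h4 : C * √(ε + (s + T - s)) ≤ C * 1 := by gcongr
  have h5 : Real.exp (-(1 / 2 * (Real.log d.factorial + d * Real.log (2 * M * T)) + 2 + C)) ≤
      Real.exp (-(1 / 2 * Real.log (Pmat H x0 s ε (s + T)).det + 1 / 4 * barN H x0 s ε (s + T) x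
    + Real.sqrt (ε + (s + T - s)) * barN H x0 s ε (s + T) x ^ 2
    + C * Real.sqrt (ε + (s + T - s)))) := by
    rw [Real.exp_le_exp]; linarith
  rw [bar]; linarith

lemma Hypotheses.delta {d : ℕ} (H : Hypotheses d) {R : ℝ} (hR : 0 < R) :
    ∃ T c1 r1 : ℝ, 0 < T ∧ 0 < c1 ∧ 0 < r1 ∧ ∀ s, 0 ≤ s → ∀ x0 : Ed d, ‖x0‖ ≤ R → ∀ ε, 0 < ε →
      ε ≤ T → ∀ x, ‖x - x0‖ ≤ r1 → c1 ≤ H.G (s + T) s (gf x0 ε) x := by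
  obtain ⟨B, hB, hbB⟩ := H.b_bdd (R := R + 2) (by linarith)
  obtain ⟨M0, hM0, hqM, L, hL, hqL⟩ := H.q_lip (R := R + 2) (by linarith)
  have hη₀ := H.hη₀
  obtain ⟨η, hη, hη0, hη1⟩ : ∃ η, 0 < η ∧ η ≤ H.η₀ ∧ η ≤ 1 :=
    ⟨min H.η₀ 1, by positivity, min_le_left _ _, min_le_right _ _⟩
  obtain ⟨M, hM1, hMM⟩ : ∃ M, 1 ≤ M ∧ M0 ≤ M := ⟨max M0 1, le_max_right _ _, le_max_left _ _⟩
  obtain ⟨C, hC⟩ : ∃ C : ℝ, 2 * (2 * ((d ^ 2 * L / η) * Real.sqrt (d ^ 2 * M + 1) + 12 * (d ^ 2 * M / η)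
        + 5 * (B / Real.sqrt η)) + 3 * ((d ^ 2 * L / η) * Real.sqrt (d ^ 2 * M + 1)
        + 12 * (d ^ 2 * M / η) + 5 * (B / Real.sqrt η)) *
      (12 * ((d ^ 2 * L / η) * Real.sqrt (d ^ 2 * M + 1) + 12 * (d ^ 2 * M / η)
        + 5 * (B / Real.sqrt η))) ^ 3) = C := ⟨_, rfl⟩
  have hC0 : 0 ≤ C := by rw [← hC]; positivity
  obtain ⟨K1, hK1⟩ : ∃ K1 : ℝ, d ^ 2 * L / η = K1 := ⟨_, rfl⟩
  have hK10 : 0 ≤ K1 := by rw [← hK1]; positivity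
  obtain ⟨r, hr0, hr1, hrK⟩ : ∃ r : ℝ, 0 < r ∧ r ≤ 1 ∧ 2 * K1 * r ≤ 1 / 4 := by
    refine ⟨1 / (8 * (K1 + 1)), by positivity, ?_, ?_⟩
    · rw [div_le_one (by positivity)]; linarith
    · rw [mul_one_div, div_le_iff₀ (by positivity)]; linarith
  obtain ⟨K0, hK0⟩ : ∃ K0 : ℝ, 8 * (d ^ 2 * M + 1) * (1 / 2 * d + Real.log d.factorial
      + 1 / 2 * d * Real.log (M / η) + C + 3) = K0 := ⟨_, rfl⟩
  have hfac : (1:ℝ) ≤ d.factorial := by exact_mod_cast Nat.one_le_iff_ne_zero.2 d.factorial_ne_zero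
  have hlf := Real.log_nonneg hfac
  have hl0 : 0 ≤ Real.log (M / η) :=
    Real.log_nonneg (by rw [le_div_iff₀ hη, one_mul]; linarith)
  have hK00 : 0 < K0 := by rw [← hK0]; positivity
  obtain ⟨T, hT, hT1, hTr⟩ : ∃ T : ℝ, 0 < T ∧ T ≤ 1 / 2 ∧ T * K0 ≤ r ^ 2 := by
    refine ⟨min (1 / 2) (r ^ 2 / K0), by positivity, min_le_left _ _, ?_⟩
    rw [← le_div_iff₀ hK00]; exact min_le_right _ _
  obtain ⟨m0, hm0⟩ : ∃ m0 : ℝ, Real.exp (-(1 / 2 * (Real.log d.factorial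
      + d * Real.log (2 * M * T)) + 2 + C)) / 2 = m0 := ⟨_, rfl⟩
  have hm00 : 0 < m0 := by rw [← hm0]; positivity
  refine ⟨T, m0, min r √(η * T), hT, hm00, by positivity, ?_⟩
  intro s hs x0 hx0 ε hε hεT x hx
  have hball : ∀ y, ‖y - x0‖ ≤ r → ‖y‖ < R + 2 := by
    intro y hy
    have : ‖y‖ ≤ ‖y - x0‖ + ‖x0‖ := by simpa using norm_add_le (y - x0) x0
    linarith
  have hMq : ∀ t, 0 ≤ t → ∀ y, ‖y - x0‖ ≤ r → ∀ i j, |H.q t y i j| ≤ M :=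
    fun t ht y hy i j => (hqM t ht y (hball y hy) i j).trans hMM
  have hMq0 : ∀ t, 0 ≤ t → ∀ i j, |H.q t x0 i j| ≤ M :=
    fun t ht => hMq t ht x0 (by simpa using hr0.le)
  have hLq : ∀ t, 0 ≤ t → ∀ y, ‖y - x0‖ ≤ r → ∀ i j,
      |H.q t y i j - H.q t x0 i j| ≤ L * ‖y - x0‖ :=
    fun t ht y hy i j => hqL t ht y x0 (hball y hy) (by linarith) i j
  have hBb : ∀ t, 0 ≤ t → ∀ y, ‖y - x0‖ ≤ r → ‖H.b t y‖ ≤ B :=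
    fun t ht y hy => hbB t ht y (hball y hy).le
  have hf := gf_Cb x0 hε
  have hf0 : ∀ x, 0 ≤ gf x0 ε x := fun x => (Real.exp_pos _).le
  have sol := H.G_sol s hs _ hf
  have hu0 := H.G_nonneg hs hf hf0
  have hcen : m0 ≤ bar H x0 s ε C m0 (s + T) x := by
    have := bar_center (s := s) (x := x) H x0 hε hεT hT1 hη hη0 hη1 hM1 hC0 hMq0
      (hx.trans (min_le_right _ _))
    rwa [hm0] at this
  refine hcen.trans ?_
  refine comparison H.q H.b (fun t => H.G t s (gf x0 ε)) (bar H x0 s ε C m0)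
    (Icc s (s + T) ×ˢ closedBall x0 r) (isCompact_Icc.prod (isCompact_closedBall _ _)) ?_ ?_ s
    ?_ ?_ ?_ (s + T) x ?_
  · exact sol.cont.mono fun z hz => ⟨hz.1.1, mem_univ _⟩
  · exact (bar_cont H x0 hε).mono fun z hz => ⟨hz.1.1, mem_univ _⟩
  · exact fun z hz => hz.1.1
  · intro z hz
    have : 0 ≤ z.1 := hs.trans hz.1.1
    exact ⟨H.q_symm _ this _, H.psd this _⟩
  · rintro t z ⟨⟨ht, ht'⟩, hz⟩ hlt
    simp only at ht ht' hz hlt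
    rw [mem_closedBall, dist_eq_norm] at hz
    have hwpos : 0 < bar H x0 s ε C m0 t z := lt_of_le_of_lt (hu0 t ht z) hlt
    have hzr : ‖z - x0‖ < r := by
      rcases hz.lt_or_eq with h | h
      · exact h
      · exfalso
        have := bar_bdry H x0 ht ht' hε hεT hη hη0 hη1 hM1 hC0 hMq0 h (by rw [hK0]; exact hTr)
        rw [hm0] at this
        linarith
    have hst : s < t := by
      rcases ht.lt_or_eq with h | h
      · exact h
      · exfalso
        subst h
        have h1 := bar_init H x0 (s := s) hε hC0 hm00.le z
        have h2 := sol.init z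
        linarith
    refine ⟨cyl_nhds hst ht' hzr, (sol.smooth_space t hst).contDiffAt,
      (bar_smooth H x0 s ε C m0 t).contDiffAt, ?_⟩
    obtain ⟨w', hw1, hw2⟩ := bar_sub H x0 (m0 := m0) hs hst hε (by linarith) hη hη0 hη1 hM1 hL.le hB.le
      hMq hLq hBb (by rw [hK1]; exact hrK) hz hC.le
    exact ⟨_, w', sol.pde t hst z, hw1, rfl, hw2⟩
  · refine ⟨⟨by linarith, le_rfl⟩, ?_⟩
    rw [mem_closedBall, dist_eq_norm]
    exact hx.trans (min_le_left _ _)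

lemma density_limit {d : ℕ} {ρ : Ed d → ℝ} (hρc : Continuous ρ)
    (hμ : IsProbabilityMeasure (volume.withDensity fun x => ENNReal.ofReal (ρ x))) {T m : ℝ}
    (hT : 0 < T) (hm : 0 < m) (x0 : Ed d)
    (h : ∀ ε, 0 < ε → ε ≤ T →
      m ≤ ∫ x, gf x0 ε x ∂(volume.withDensity fun x => ENNReal.ofReal (ρ x))) :
    (4 * Real.pi) ^ (-(d:ℝ) / 2) * m ≤ ρ x0 := by
  have hpi := Real.pi_pos
  have hmeas : Measurable fun x => ENNReal.ofReal (ρ x) := by fun_prop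
  set ρp : Ed d → ℝ := fun x => max (ρ x) 0 with hρp
  have hρpc : Continuous ρp := by fun_prop
  have hIntg : Integrable ρp := by
    refine ⟨hρpc.aestronglyMeasurable, ?_⟩
    have h1 := hμ.measure_univ
    rw [withDensity_apply _ MeasurableSet.univ, Measure.restrict_univ] at h1
    rw [hasFiniteIntegral_iff_norm]
    have : ∀ x, ENNReal.ofReal ‖ρp x‖ = ENNReal.ofReal (ρ x) := by
      intro x
      rw [Real.norm_of_nonneg (le_max_right _ _)]
      simp [hρp, ENNReal.ofReal_max]
    simp only [this, h1]
    exact ENNReal.one_lt_top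
  have heq : ∀ ε, ∫ x, gf x0 ε x ∂(volume.withDensity fun x => ENNReal.ofReal (ρ x))
      = ∫ x, ρp x * gf x0 ε x := by
    intro ε
    rw [integral_withDensity_eq_integral_toReal_smul hmeas (by simp)]
    simp [ENNReal.toReal_ofReal', hρp]
  have hlim := Real.tendsto_integral_gaussian_smul' (f := fun x => (ρp x : ℂ)) hIntg.ofReal (v := x0)
    (by fun_prop)
  have hre := (Complex.continuous_re.tendsto _).comp hlim
  simp only [Complex.ofReal_re] at hre
  have hge : (4 * Real.pi) ^ (-(d:ℝ) / 2) * m ≤ ρp x0 := by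
    refine ge_of_tendsto hre ?_
    filter_upwards [eventually_gt_atTop 0, eventually_ge_atTop (1 / (4 * Real.pi ^ 2 * T))]
      with c hc hcT
    set ε := 1 / (4 * Real.pi ^ 2 * c) with hε
    have hε0 : 0 < ε := by positivity
    have hεT : ε ≤ T := by
      rw [hε, div_le_iff₀ (by positivity)]
      rw [div_le_iff₀ (by positivity)] at hcT
      linarith
    have hpt : ∀ w, ((Real.pi * c : ℂ) ^ (Module.finrank ℝ (Ed d) / 2 : ℂ) *
        Complex.exp (-Real.pi ^ 2 * c * ‖x0 - w‖ ^ 2)) • (ρp w : ℂ)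
        = (((4 * Real.pi) ^ (-(d:ℝ) / 2) * (ρp w * gf x0 ε w) : ℝ) : ℂ) := by
      intro w
      have e1 : ((Real.pi * c : ℂ) ^ (Module.finrank ℝ (Ed d) / 2 : ℂ))
          = (((Real.pi * c) ^ ((d:ℝ) / 2) : ℝ) : ℂ) := by
        rw [Complex.ofReal_cpow (by positivity)]
        simp
      have e2 : Complex.exp (-Real.pi ^ 2 * c * ‖x0 - w‖ ^ 2)
          = ((Real.exp (-Real.pi ^ 2 * c * ‖x0 - w‖ ^ 2) : ℝ) : ℂ) := by
        push_cast; rfl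
      rw [e1, e2, smul_eq_mul, ← Complex.ofReal_mul, ← Complex.ofReal_mul]
      congr 1
      have e3 : gf x0 ε w = ε ^ (-(d:ℝ) / 2) * Real.exp (-Real.pi ^ 2 * c * ‖x0 - w‖ ^ 2) := by
        rw [Real.rpow_def_of_pos hε0, ← Real.exp_add, gf, norm_sub_rev w x0]
        congr 1
        rw [hε]
        field_simp
        ring
      have e4 : (Real.pi * c) ^ ((d:ℝ) / 2) = (4 * Real.pi) ^ (-(d:ℝ) / 2) * ε ^ (-(d:ℝ) / 2) := by
        rw [← Real.mul_rpow (by positivity) hε0.le, neg_div, Real.rpow_neg (by positivity),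
          ← Real.inv_rpow (by positivity)]
        congr 1
        rw [hε]; field_simp
      rw [e3, e4]; ring
    simp only [Function.comp_apply]
    simp only [hpt]
    rw [integral_complex_ofReal, Complex.ofReal_re, integral_const_mul, ← heq]
    have := h ε hε0 hεT
    gcongr
  have hpos : 0 < ρp x0 := lt_of_lt_of_le (by positivity) hge
  have : ρp x0 = ρ x0 := by
    rcases max_choice (ρ x0) 0 with h1 | h1
    · exact h1
    · exfalso
      simp only [hρp, h1] at hpos
      exact lt_irrefl _ hpos
  rwa [this] at hge

/-- Under Hypotheses (H), if the tight evolution system of measures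
`{μ_t : t ≥ 0}` has continuous densities `ρ(t,·)` w.r.t. the Lebesgue measure, then for
each `k ∈ ℕ` there is `δ_k > 0` with `ρ(τ,x) ≥ δ_k` for all `τ ≥ 0` and `|x| ≤ k`. -/
theorem density_lower_bound (d : ℕ) (H : Hypotheses d) (μ : ℝ → Measure (Ed d))
    (hsys : IsEvolutionSystem H μ) (htight : IsTightSystem μ)
    (ρ : ℝ → Ed d → ℝ) (hρcont : ∀ t ∈ Ici (0:ℝ), Continuous (ρ t))
    (hρ : ∀ t ∈ Ici (0:ℝ), μ t = volume.withDensity fun x => ENNReal.ofReal (ρ t x)) :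
    ∀ k : ℕ, ∃ δ > (0:ℝ), ∀ τ ∈ Ici (0:ℝ), ∀ x : Ed d, ‖x‖ ≤ k → δ ≤ ρ τ x := by
  intro k
  obtain ⟨R0, hR0, hR⟩ := htight (1 / 2) (by norm_num)
  have hpi := Real.pi_pos
  obtain ⟨R, hRR, hRk⟩ : ∃ R : ℝ, R0 ≤ R ∧ (k:ℝ) ≤ R := ⟨max R0 k, le_max_left _ _, le_max_right _ _⟩
  have hRpos : 0 < R := hR0.trans_le hRR
  obtain ⟨T, c1, r1, hT, hc1, hr1, hdelta⟩ := H.delta hRpos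
  obtain ⟨c, hc, hexp⟩ := H.expand hRpos hr1
  refine ⟨(4 * Real.pi) ^ (-(d:ℝ) / 2) * (c * c1 / 2), by positivity, ?_⟩
  intro s hs x0 hx0
  have hs' : (0:ℝ) ≤ s := hs
  have hprob := hsys.1 s hs
  rw [hρ s hs] at hprob
  refine density_limit (hρcont s hs) hprob hT (by positivity) x0 ?_
  intro ε hε hεT
  rw [← hρ s hs]
  have hf := gf_Cb x0 hε
  have hf0 : ∀ x, 0 ≤ gf x0 ε x := fun x => (Real.exp_pos _).le
  set t := s + T + 1 with ht
  have hst : s ≤ t := by linarith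
  have ht0 : t ∈ Ici (0:ℝ) := mem_Ici.2 (hs'.trans hst)
  rw [← hsys.2 _ hf s hs t hst]
  have hprob' := hsys.1 t ht0
  have sol := H.G_sol s hs _ hf
  have hcont : Continuous (H.G t s (gf x0 ε)) := by
    have := (sol.smooth_space t (by simp only [mem_Ioi]; linarith)).continuous
    exact this
  obtain ⟨Bd, hBd⟩ := sol.bdd
  have hIntg : Integrable (H.G t s (gf x0 ε)) (μ t) :=
    Integrable.of_bound hcont.aestronglyMeasurable Bd
      (Eventually.of_forall fun x => by rw [Real.norm_eq_abs]; exact hBd t hst x)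
  have hlow : ∀ x ∈ ball (0 : Ed d) R0, c * c1 ≤ H.G t s (gf x0 ε) x := by
    intro x hx
    rw [mem_ball_zero_iff] at hx
    exact hexp s hs _ hf hf0 (s + T) (by linarith) x0 x (hx0.trans hRk) (by linarith) c1 hc1.le
      (hdelta s hs x0 (hx0.trans hRk) ε hε hεT)
  have h1 : c * c1 * (μ t).real (ball (0 : Ed d) R0) ≤ ∫ x, H.G t s (gf x0 ε) x ∂μ t := by
    refine le_trans ?_ (setIntegral_le_integral (s := ball (0 : Ed d) R0) hIntg
      (Eventually.of_forall fun x => H.G_nonneg hs hf hf0 t hst x))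
    have := setIntegral_ge_of_const_le_real (μ := μ t) (s := ball (0 : Ed d) R0) (c := c * c1)
      measurableSet_ball (measure_ne_top _ _) hlow hIntg.integrableOn
    exact this
  have h2 : 1 / 2 ≤ (μ t).real (ball (0 : Ed d) R0) := by
    have := hR t ht0
    rw [Measure.real, ← ENNReal.ofReal_le_iff_le_toReal (measure_ne_top _ _)]
    convert this using 2; norm_num
  have h3 : c * c1 * (1 / 2) ≤ c * c1 * (μ t).real (ball (0 : Ed d) R0) := by gcongr
  linarith
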